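/- Let N ≥ 3 be an integer, k an odd positive integer, l = k·2^N, and let m ≥ 2N+1 be an integer with m ≡ 4 (mod 8); set n = m + l and assume n ≥ 12. Then, in ℚ[c_1,…,c_n], B̂_n/n ≡ c_1^l·(B̂_m/m) + (l − l/(2mn))·c_1^n + (l/2)·c_1^{n−3}c_3 + (l/4)·(c_1^{n−6}c_3^2 + c_1^{n−12}c_3^4) + l·(c_1^{n−8}c_2c_3^2 + c_1^{n−5}c_2c_3) (mod 2^{N+1}ℤ_2[c_1,…,c_n]). -/

import Mathlib

open Finsupp MvPolynomial

noncomputable section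

/-- weight of a partition (given as the multiplicity function of its parts) -/
def wt (u : ℕ →₀ ℕ) : ℕ := u.sum fun i m => i * m

/-- degree (number of parts) -/
def deg (u : ℕ →₀ ℕ) : ℕ := u.sum fun _ m => m

/-- γ_u = Π_i (i+1)^{u_i} (u_i)! -/
def gam (u : ℕ →₀ ℕ) : ℕ := u.prod fun i m => (i + 1) ^ m * m.factorial

/-- τ_u = (−1)^{d(u)−1} (w(u)+d(u)−2)! / γ_u -/
def tau (u : ℕ →₀ ℕ) : ℚ :=
  (-1 : ℚ) ^ (deg u - 1) * (Nat.factorial (wt u + deg u - 2) : ℚ) / (gam u : ℚ)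

/-- p-adic valuation on ℚ with v_p(0) = ⊤ -/
def pval (p : ℕ) (x : ℚ) : WithTop ℤ :=
  if x = 0 then ⊤ else ((padicValRat p x : ℤ) : WithTop ℤ)

/-- divided universal Bernoulli number B̂_n/n = Σ_{w(u)=n} τ_u c^u, as a
multivariate polynomial in the variables c_1, c_2, … (variable i is c_i). -/
def divB (n : ℕ) : MvPolynomial ℕ ℚ :=
  ∑ P : n.Partition, (tau P.parts.toFinsupp) • MvPolynomial.monomial P.parts.toFinsupp (1 : ℚ)

/-- F ≡ G (mod p^t ℤ_p[c_1,…]) : every coefficient of F − G has v_p ≥ t -/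
def PCong (p t : ℕ) (F G : MvPolynomial ℕ ℚ) : Prop :=
  ∀ u : ℕ →₀ ℕ, ((t : ℤ) : WithTop ℤ) ≤ pval p (MvPolynomial.coeff u (F - G))

/-- The product of the first `q` odd positive integers. -/
def oddProd (q : ℕ) : ℕ := ∏ i ∈ Finset.range q, (2 * i + 1)

/-- The product of the `L` integers `x + 1, x + 3, …, x + 2L - 1`. -/
def oddBlock (x : ℤ) (L : ℕ) : ℤ := ∏ i ∈ Finset.range L, (x + 2 * i + 1)

theorem oddProd_succ (q : ℕ) : oddProd (q + 1) = oddProd q * (2 * q + 1) :=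
  Finset.prod_range_succ _ _

theorem oddBlock_succ (x : ℤ) (L : ℕ) :
    oddBlock x (L + 1) = oddBlock x L * (x + 2 * L + 1) :=
  Finset.prod_range_succ _ _

theorem oddBlock_add (x : ℤ) (K L : ℕ) :
    oddBlock x (K + L) = oddBlock x K * oddBlock (x + 2 * K) L := by
  induction L with
  | zero => simp [oddBlock]
  | succ L ih => rw [← add_assoc, oddBlock_succ, ih, oddBlock_succ]; push_cast; ring

theorem oddProd_add (q L : ℕ) :
    (oddProd (q + L) : ℤ) = oddProd q * oddBlock (2 * q) L := by
  induction L with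
  | zero => simp [oddBlock]
  | succ L ih => rw [← add_assoc, oddProd_succ, oddBlock_succ]; push_cast; rw [ih]; ring

theorem odd_oddProd (q : ℕ) : Odd (oddProd q) := by
  induction q with
  | zero => simp [oddProd]
  | succ q ih => rw [oddProd_succ]; exact ih.mul (odd_two_mul_add_one q)

theorem factorial_two_mul_eq (q : ℕ) :
    (2 * q).factorial = 2 ^ q * q.factorial * oddProd q := by
  induction q with
  | zero => simp [oddProd]
  | succ q ih =>
    rw [show 2 * (q + 1) = 2 * q + 1 + 1 by ring, Nat.factorial_succ, Nat.factorial_succ, ih,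
      oddProd_succ, Nat.factorial_succ]
    ring

theorem factorial_two_mul_add_eq (q ε : ℕ) (hε : ε ≤ 1) :
    (2 * q + ε).factorial = 2 ^ q * q.factorial * oddProd (q + ε) := by
  interval_cases ε
  · exact factorial_two_mul_eq q
  · rw [Nat.factorial_succ, factorial_two_mul_eq, oddProd_succ]; ring

theorem oddBlock_shift_two (x : ℤ) (L : ℕ) :
    oddBlock (x + 2) L * (x + 1) = oddBlock x L * (x + 2 * L + 1) := by
  rw [← oddBlock_succ, add_comm L 1, oddBlock_add]
  simp [oddBlock]; ring

theorem oddBlock_shift_eight (x : ℤ) (L : ℕ) :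
    oddBlock (x + 8) L * oddBlock x 4 = oddBlock x L * oddBlock (x + 2 * L) 4 := by
  rw [← oddBlock_add, add_comm L 4, oddBlock_add]
  push_cast; ring_nf

theorem isCoprime_two_pow_of_odd {a : ℤ} (ha : Odd a) (r : ℕ) : IsCoprime ((2 : ℤ) ^ r) a := by
  obtain ⟨k, hk⟩ := ha
  exact IsCoprime.pow_left ⟨-k, 1, by rw [hk]; ring⟩

theorem two_pow_dvd_oddBlock_shift_eight (N L : ℕ) (hL : 2 ^ N ∣ L) (hN : 3 ≤ N) (y : ℤ) :
    (2 : ℤ) ^ (N + 4) ∣ oddBlock (8 * y + 8) L - oddBlock (8 * y) L := by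
  have hodd : Odd (oddBlock (8 * y) 4) := by
    simp only [oddBlock, Finset.prod_range_succ, Finset.prod_range_zero]
    refine ((((odd_one.mul ?_).mul ?_).mul ?_).mul ?_) <;>
      exact Int.odd_iff.mpr (by push_cast; omega)
  refine (isCoprime_two_pow_of_odd hodd (N + 4)).dvd_of_dvd_mul_right ?_
  rw [sub_mul, oddBlock_shift_eight, ← mul_sub]
  refine Dvd.dvd.mul_left ?_ _
  obtain ⟨c, rfl⟩ := hL
  obtain ⟨r, rfl⟩ := Nat.exists_eq_add_of_le hN
  simp only [oddBlock, Finset.prod_range_succ, Finset.prod_range_zero]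
  push_cast
  generalize hp : (2 : ℤ) ^ r = p
  rw [show (2 : ℤ) ^ (3 + r + 4) = 128 * p by rw [← hp]; ring,
    show (2 : ℤ) ^ (3 + r) = 8 * p by rw [← hp]; ring]
  refine ⟨c * (256 * y ^ 3 + 384 * y ^ 2 + 172 * y + 22) + 2 * p * c ^ 2 * (384 * y ^ 2 + 384 * y
    + 86 + 16 * p * c * (32 * y + 16) + 256 * p ^ 2 * c ^ 2), ?_⟩
  ring

theorem two_pow_dvd_oddBlock_shift_two (N L : ℕ) (hL : 2 ^ N ∣ L) (y : ℤ) :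
    (2 : ℤ) ^ (N + 1) ∣ oddBlock (2 * y + 2) L - oddBlock (2 * y) L := by
  refine (isCoprime_two_pow_of_odd (odd_two_mul_add_one y) (N + 1)).dvd_of_dvd_mul_right ?_
  rw [sub_mul, oddBlock_shift_two, ← mul_sub]
  refine Dvd.dvd.mul_left ?_ _
  obtain ⟨c, rfl⟩ := hL
  exact ⟨c, by push_cast; ring⟩

/-- A function on `ℤ` which is periodic modulo `d` is constant modulo `d`. -/
theorem dvd_sub_of_dvd_succ_sub {d : ℤ} (f : ℤ → ℤ) (h : ∀ y, d ∣ f (y + 1) - f y) (x y : ℤ) :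
    d ∣ f x - f y := by
  have key : ∀ z, d ∣ f z - f 0 := by
    intro z
    induction z using Int.induction_on with
    | zero => simp
    | succ i ih => simpa using dvd_add (h i) ih
    | pred i ih =>
      have h1 := h (-i - 1)
      rw [sub_add_cancel] at h1
      simpa using dvd_sub ih h1
  simpa using dvd_sub (key x) (key y)

theorem oddBlock_symm (L : ℕ) : oddBlock (-(2 * L)) (2 * L) = (-1) ^ L * oddBlock 0 L ^ 2 := by
  have h1 : oddBlock (-(2 * L)) L = (-1) ^ L * oddBlock 0 L := by
    unfold oddBlock
    have h2 : (-1 : ℤ) ^ L = ∏ _i ∈ Finset.range L, (-1 : ℤ) := by simp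
    rw [← Finset.prod_range_reflect, h2, ← Finset.prod_mul_distrib]
    refine Finset.prod_congr rfl fun i hi => ?_
    have := Finset.mem_range.mp hi
    rw [Nat.sub_sub, Nat.cast_sub (by omega)]
    push_cast; ring
  rw [two_mul L, oddBlock_add, h1, neg_add_cancel]
  ring

theorem two_pow_dvd_oddBlock_sub (N : ℕ) (hN : 3 ≤ N) (y : ℤ) :
    (2 : ℤ) ^ (N + 4) ∣ oddBlock (8 * y) (2 ^ N) - (1 + 2 ^ (N + 1)) := by
  have hc : ∀ M, 3 ≤ M → ∀ x y : ℤ,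
      (2 : ℤ) ^ (M + 4) ∣ oddBlock (8 * x) (2 ^ M) - oddBlock (8 * y) (2 ^ M) := fun M hM =>
    dvd_sub_of_dvd_succ_sub (fun x => oddBlock (8 * x) (2 ^ M)) fun z => by
      simpa [mul_add] using two_pow_dvd_oddBlock_shift_eight M (2 ^ M) dvd_rfl hM z
  induction N, hN using Nat.le_induction generalizing y with
  | base =>
    have h := hc 3 le_rfl y 0
    have h0 : (2 : ℤ) ^ (3 + 4) ∣ oddBlock (8 * 0) (2 ^ 3) - (1 + 2 ^ (3 + 1)) := by
      simp only [oddBlock]; decide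
    simpa using dvd_add h h0
  | succ N hN ih =>
    obtain ⟨r, rfl⟩ := Nat.exists_eq_add_of_le hN
    have h := hc (3 + r + 1) (by omega) y (-2 ^ (r + 1))
    have e : oddBlock (8 * (-2 ^ (r + 1))) (2 ^ (3 + r + 1)) = oddBlock 0 (2 ^ (3 + r)) ^ 2 := by
      have := oddBlock_symm (2 ^ (3 + r))
      rw [Even.neg_one_pow ((Nat.even_pow.mpr ⟨even_two, by omega⟩)), one_mul] at this
      rw [← this]
      push_cast
      congr 1 <;> ring
    obtain ⟨q, hq⟩ := ih 0
    rw [mul_zero, sub_eq_iff_eq_add] at hq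
    have h0 : (2 : ℤ) ^ (3 + r + 1 + 4) ∣
        oddBlock (8 * (-2 ^ (r + 1))) (2 ^ (3 + r + 1)) - (1 + 2 ^ (3 + r + 1 + 1)) := by
      rw [e, hq]
      refine ⟨q * (1 + 2 ^ (3 + r + 1)) + 2 ^ (3 + r + 3) * q ^ 2 + 2 ^ r, ?_⟩
      ring
    simpa using dvd_add h h0

theorem two_pow_dvd_oddBlock_mul_sub (N k : ℕ) (hN : 3 ≤ N) (y : ℤ) :
    (2 : ℤ) ^ (N + 4) ∣ oddBlock (8 * y) (k * 2 ^ N) - (1 + 2 * (k * 2 ^ N : ℕ)) := by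
  induction k with
  | zero => simp [oddBlock]
  | succ k ih =>
    obtain ⟨r, rfl⟩ := Nat.exists_eq_add_of_le hN
    rw [add_mul, one_mul, oddBlock_add]
    obtain ⟨a, ha⟩ := ih
    obtain ⟨b, hb⟩ := two_pow_dvd_oddBlock_sub (3 + r) hN (y + 2 * (k * 2 ^ r))
    rw [show 8 * (y + 2 * (k * 2 ^ r)) = 8 * y + 2 * ((k * 2 ^ (3 + r) : ℕ) : ℤ) by
      push_cast; ring] at hb
    rw [sub_eq_iff_eq_add] at ha hb
    rw [ha, hb]
    push_cast
    refine ⟨2 ^ (3 + r + 4) * a * b + a * (1 + 2 ^ (3 + r + 1)) + b * (1 + 2 * (k * 2 ^ (3 + r)))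
      + k * 2 ^ (r + 1), ?_⟩
    ring

theorem two_pow_dvd_oddBlock_sub_one (N k : ℕ) (hN : 3 ≤ N) (y : ℤ) :
    (2 : ℤ) ^ (N + 1) ∣ oddBlock (2 * y) (k * 2 ^ N) - 1 := by
  have h := dvd_sub_of_dvd_succ_sub (d := 2 ^ (N + 1))
    (fun x => oddBlock (2 * x) (k * 2 ^ N)) (fun z => by
      simpa [mul_add] using two_pow_dvd_oddBlock_shift_two N (k * 2 ^ N) (dvd_mul_left _ _) z) y 0
  have h1 : (2 : ℤ) ^ (N + 1) ∣ oddBlock (8 * 0) (k * 2 ^ N) - (1 + 2 * (k * 2 ^ N : ℕ)) :=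
    (pow_dvd_pow 2 (by omega)).trans (two_pow_dvd_oddBlock_mul_sub N k hN 0)
  have h2 : (2 : ℤ) ^ (N + 1) ∣ 2 * (k * 2 ^ N : ℕ) := ⟨k, by push_cast; ring⟩
  have := dvd_add h (dvd_add h1 h2)
  exact this.trans (dvd_of_eq (by rw [mul_zero, mul_zero]; ring))

theorem oddProd_eight_mul_add_four (t : ℕ) :
    (128 : ℤ) ∣ oddProd (8 * t + 4) - 105 * (1 + 16 * t) := by
  have h := two_pow_dvd_oddBlock_mul_sub 3 t le_rfl 1
  have e := oddProd_add 4 (t * 2 ^ 3)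
  rw [show 8 * t + 4 = 4 + t * 2 ^ 3 by ring, e, show oddProd 4 = 105 from rfl]
  have := h.mul_left 105
  exact this.trans (dvd_of_eq (by push_cast; ring))

theorem padicValNat_two_factorial_two_mul (j : ℕ) :
    padicValNat 2 (2 * j).factorial = padicValNat 2 j.factorial + j :=
  padicValNat_factorial_mul j

theorem padicValNat_two_factorial_two_mul_add_one (j : ℕ) :
    padicValNat 2 (2 * j + 1).factorial = padicValNat 2 j.factorial + j := by
  rw [padicValNat_factorial_mul_add j (by norm_num), padicValNat_two_factorial_two_mul]

theorem padicValNat_two_factorial_succ (j : ℕ) :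
    padicValNat 2 (j + 1).factorial = padicValNat 2 (j + 1) + padicValNat 2 j.factorial := by
  rw [Nat.factorial_succ, padicValNat.mul (by omega) (Nat.factorial_ne_zero j)]

theorem padicValNat_two_factorial_mono {i j : ℕ} (h : i ≤ j) :
    padicValNat 2 i.factorial ≤ padicValNat 2 j.factorial :=
  (padicValNat_dvd_iff_le (Nat.factorial_ne_zero j)).mp
    (pow_padicValNat_dvd.trans (Nat.factorial_dvd_factorial h))

theorem padicValNat_two_factorial_eq_half (s : ℕ) :
    padicValNat 2 s.factorial = padicValNat 2 (s / 2).factorial + s / 2 := by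
  rw [← padicValNat_two_factorial_two_mul, padicValNat_mul_div_factorial]

theorem log_two_eq_half {s : ℕ} (h : 2 ≤ s) : Nat.log 2 s = Nat.log 2 (s / 2) + 1 :=
  Nat.log_of_one_lt_of_le (by norm_num) h

theorem log_two_lt_self {t : ℕ} (h : t ≠ 0) : Nat.log 2 t < t :=
  Nat.log_lt_of_lt_pow h Nat.lt_two_pow_self

theorem one_le_padicValNat_two {n : ℕ} (h0 : n ≠ 0) (h : 2 ∣ n) : 1 ≤ padicValNat 2 n :=
  one_le_padicValNat_of_dvd h0 h

theorem log_le_factorial_of_two_mul_add_one_le {j s : ℕ} (h : 2 * j + 1 ≤ s) :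
    padicValNat 2 j.factorial + Nat.log 2 s ≤ padicValNat 2 s.factorial := by
  rcases Nat.lt_or_ge s 2 with hs | hs
  · have h1 : s = 1 := by omega
    have h0 : j = 0 := by omega
    simp [h1, h0]
  · rw [padicValNat_two_factorial_eq_half s, log_two_eq_half hs]
    have h1 := padicValNat_two_factorial_mono (show j ≤ s / 2 by omega)
    have h2 := log_two_lt_self (show s / 2 ≠ 0 by omega)
    omega

theorem log_lt_factorial_of_two_mul_add_four_le {j s : ℕ} (h : 2 * j + 4 ≤ s) :
    padicValNat 2 j.factorial + Nat.log 2 s + 1 ≤ padicValNat 2 s.factorial := by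
  rw [padicValNat_two_factorial_eq_half s, log_two_eq_half (by omega)]
  have h1 := padicValNat_two_factorial_mono (show j + 2 ≤ s / 2 by omega)
  have h2 := log_two_lt_self (show s / 2 ≠ 0 by omega)
  rw [padicValNat_two_factorial_succ (j + 1), padicValNat_two_factorial_succ j] at h1
  rcases Nat.even_or_odd' j with ⟨c, hc | hc⟩
  · have := one_le_padicValNat_two (show j + 1 + 1 ≠ 0 by omega) (by omega)
    omega
  · have := one_le_padicValNat_two (show j + 1 ≠ 0 by omega) (by omega)
    omega

theorem succ_lt_two_pow {j : ℕ} (h : 2 ≤ j) : j + 1 < 2 ^ j := by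
  induction j, h using Nat.le_induction with
  | base => norm_num
  | succ j hj ih => rw [pow_succ]; omega

theorem log_lt_factorial_two_mul_add_three {j : ℕ} (h : 1 ≤ j) :
    padicValNat 2 j.factorial + Nat.log 2 (2 * j + 3) + 1
      ≤ padicValNat 2 (2 * j + 3).factorial := by
  rw [padicValNat_two_factorial_eq_half (2 * j + 3), log_two_eq_half (by omega),
    show (2 * j + 3) / 2 = j + 1 by omega, padicValNat_two_factorial_succ j]
  rcases Nat.lt_or_ge j 2 with h1 | h1
  · obtain rfl : j = 1 := by omega
    have h2 : Nat.log 2 2 = 1 := by norm_num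
    simp [h2]
  · have := Nat.log_lt_of_lt_pow (by omega) (succ_lt_two_pow h1)
    omega

theorem log_lt_factorial_two_mul {j : ℕ} (h : 3 ≤ j) :
    padicValNat 2 j.factorial + Nat.log 2 (2 * j) + 1 ≤ padicValNat 2 (2 * j).factorial := by
  rw [padicValNat_two_factorial_two_mul, log_two_eq_half (by omega),
    Nat.mul_div_cancel_left _ (by norm_num)]
  obtain ⟨i, rfl⟩ := Nat.exists_eq_add_of_le' (show 1 ≤ j by omega)
  have := Nat.log_lt_of_lt_pow (by omega) (succ_lt_two_pow (show 2 ≤ i by omega))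
  omega

theorem two_mul_log_two_add_four_le {j : ℕ} (h : 10 ≤ j) : 2 * Nat.log 2 j + 4 ≤ j := by
  have key : ∀ i, 3 ≤ i → i + 3 ≤ 2 ^ i := by
    intro i hi
    induction i, hi using Nat.le_induction with
    | base => norm_num
    | succ i hi ih => rw [pow_succ]; omega
  rcases Nat.lt_or_ge j 16 with h1 | h1
  · have := Nat.log_lt_of_lt_pow (b := 2) (x := 4) (y := j) (by omega) (by omega)
    omega
  · have h2 := key (j / 2 - 2) (by omega)
    have := Nat.log_lt_of_lt_pow (b := 2) (x := j / 2 - 1) (y := j) (by omega)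
      (by rw [show j / 2 - 1 = j / 2 - 2 + 1 by omega, pow_succ]; omega)
    omega

theorem padicValNat_two_le_log (j : ℕ) : padicValNat 2 j ≤ Nat.log 2 j :=
  padicValNat_le_nat_log j

theorem padicValNat_two_factorial_two_mul_sub_one {j : ℕ} (h : 1 ≤ j) :
    padicValNat 2 (2 * j - 1).factorial + padicValNat 2 j + 1 = padicValNat 2 j.factorial + j := by
  obtain ⟨i, rfl⟩ := Nat.exists_eq_add_of_le' h
  have h1 := padicValNat_two_factorial_succ i
  rw [show 2 * (i + 1) - 1 = 2 * i + 1 by omega, padicValNat_two_factorial_two_mul_add_one]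
  omega

theorem log_lt_factorial_two_mul_sub_one {j : ℕ} (h : j = 7 ∨ 9 ≤ j) :
    padicValNat 2 j.factorial + Nat.log 2 (2 * j - 1) + 2
      ≤ padicValNat 2 (2 * j - 1).factorial := by
  have h1 := padicValNat_two_factorial_two_mul_sub_one (show 1 ≤ j by omega)
  have h2 := padicValNat_two_le_log j
  have h3 : Nat.log 2 (2 * j - 1) ≤ Nat.log 2 j + 1 := by
    rw [log_two_eq_half (by omega)]
    exact Nat.add_le_add_right (Nat.log_mono_right (by omega)) 1
  rcases Nat.lt_or_ge j 10 with h4 | h4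
  · have h6 : padicValNat 2 j = 0 := padicValNat.eq_zero_of_not_dvd (by omega)
    rcases h with rfl | h
    · have h5 : Nat.log 2 (2 * 7 - 1) = 3 := by norm_num
      omega
    · obtain rfl : j = 9 := by omega
      have h5 : Nat.log 2 (2 * 9 - 1) = 4 := by norm_num
      omega
  · have := two_mul_log_two_add_four_le h4
    omega

theorem add_le_padicValNat_two_factorial {j s N : ℕ} (hN : 2 ≤ N) (h : j + 2 * N ≤ s) :
    padicValNat 2 j.factorial + N + 1 ≤ padicValNat 2 s.factorial := by
  have h1 : padicValNat 2 (j.factorial * (2 * N).factorial) ≤ padicValNat 2 s.factorial :=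
    (padicValNat_dvd_iff_le (Nat.factorial_ne_zero s)).mp (pow_padicValNat_dvd.trans
      ((Nat.factorial_mul_factorial_dvd_factorial_add j (2 * N)).trans
        (Nat.factorial_dvd_factorial h)))
  rw [padicValNat.mul (Nat.factorial_ne_zero _) (Nat.factorial_ne_zero _),
    padicValNat_two_factorial_two_mul] at h1
  have h2 := padicValNat_two_factorial_mono hN
  have h3 : padicValNat 2 (Nat.factorial 2) = 1 := by simp
  omega

theorem add_le_padicValNat_two_factorial_two_mul_sub_one {j N : ℕ} (hj : 12 ≤ j)
    (h : 2 * N + 1 ≤ j) :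
    padicValNat 2 j.factorial + N + 2 ≤ padicValNat 2 (2 * j - 1).factorial := by
  have h1 := padicValNat_two_factorial_two_mul_sub_one (show 1 ≤ j by omega)
  have h2 := padicValNat_two_le_log j
  have := two_mul_log_two_add_four_le (show 10 ≤ j by omega)
  omega

theorem wt_eq_add_erase (i : ℕ) (v : ℕ →₀ ℕ) : wt v = i * v i + wt (v.erase i) :=
  (Finsupp.add_sum_erase' v i (fun i m => i * m) (fun _ => mul_zero _)).symm

theorem deg_eq_add_erase (i : ℕ) (v : ℕ →₀ ℕ) : deg v = v i + deg (v.erase i) :=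
  (Finsupp.add_sum_erase' v i (fun _ m => m) (fun _ => rfl)).symm

theorem gam_eq_mul_erase (i : ℕ) (v : ℕ →₀ ℕ) :
    gam v = (i + 1) ^ v i * (v i).factorial * gam (v.erase i) :=
  (Finsupp.mul_prod_erase' v i (fun i m => (i + 1) ^ m * m.factorial) (fun _ => rfl)).symm

theorem gam_ne_zero (v : ℕ →₀ ℕ) : gam v ≠ 0 :=
  Finset.prod_ne_zero_iff.mpr fun _ _ =>
    mul_ne_zero (pow_ne_zero _ (Nat.succ_ne_zero _)) (Nat.factorial_ne_zero _)

@[simp] theorem wt_zero : wt 0 = 0 := rfl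
@[simp] theorem deg_zero : deg 0 = 0 := rfl
@[simp] theorem gam_zero : gam 0 = 1 := rfl

theorem padicValNat_gam (i : ℕ) (v : ℕ →₀ ℕ) :
    padicValNat 2 (gam v) = v i * padicValNat 2 (i + 1) + padicValNat 2 (v i).factorial
      + padicValNat 2 (gam (v.erase i)) := by
  rw [gam_eq_mul_erase i, padicValNat.mul (mul_ne_zero (pow_ne_zero _ (Nat.succ_ne_zero _))
    (Nat.factorial_ne_zero _)) (gam_ne_zero _), padicValNat.mul (pow_ne_zero _ (Nat.succ_ne_zero _))
    (Nat.factorial_ne_zero _), padicValNat.pow]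

theorem two_mul_padicValNat_two_succ_le {i : ℕ} (h : 4 ≤ i) (h7 : i ≠ 7) :
    2 * padicValNat 2 (i + 1) + 3 ≤ i := by
  have hd : 2 ^ padicValNat 2 (i + 1) ∣ i + 1 := pow_padicValNat_dvd
  generalize padicValNat 2 (i + 1) = a at hd
  have hle := Nat.le_of_dvd (by omega) hd
  rcases Nat.lt_or_ge a 4 with ha | ha
  · interval_cases a <;> omega
  · have key : 2 * a + 4 ≤ 2 ^ a := by
      clear hd hle
      induction a, ha using Nat.le_induction with
      | base => norm_num
      | succ a ha ih => rw [pow_succ]; omega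
    omega

theorem two_mul_part_val_add_two_le {i m : ℕ} (hi : 2 ≤ i) (hi3 : i ≠ 3) (hm : m ≠ 0) :
    2 * (m * padicValNat 2 (i + 1) + padicValNat 2 m.factorial) + 2 ≤ i * m + m := by
  have h1 := padicValNat_factorial_lt_of_ne_zero 2 hm
  rcases eq_or_ne i 7 with rfl | h7
  · have : padicValNat 2 (7 + 1) = 3 := by
      rw [show 7 + 1 = 2 ^ 3 by norm_num, padicValNat.prime_pow]
    rw [this]; omega
  · rcases eq_or_ne i 2 with rfl | h2
    · have : padicValNat 2 (2 + 1) = 0 := padicValNat.eq_zero_of_not_dvd (by norm_num)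
      rw [this]; omega
    · have h := two_mul_padicValNat_two_succ_le (show 4 ≤ i by omega) h7
      nlinarith [Nat.mul_le_mul_left m h]

theorem two_mul_part_val_add_four_le {i m : ℕ} (hi : 2 ≤ i) (hi3 : i ≠ 3) (hi7 : i ≠ 7)
    (hm : m ≠ 0) (h21 : i = 2 → m ≠ 1) :
    2 * (m * padicValNat 2 (i + 1) + padicValNat 2 m.factorial) + 4 ≤ i * m + m := by
  have h1 := padicValNat_factorial_lt_of_ne_zero 2 hm
  rcases eq_or_ne i 2 with rfl | h2
  · have : padicValNat 2 (2 + 1) = 0 := padicValNat.eq_zero_of_not_dvd (by norm_num)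
    rw [this]; have := h21 rfl; omega
  · have h := two_mul_padicValNat_two_succ_le (show 4 ≤ i by omega) hi7
    have := Nat.mul_le_mul_left m h
    have : 1 ≤ m := by omega
    nlinarith

theorem two_mul_padicValNat_gam_le (v : ℕ →₀ ℕ) (hv : ∀ i, v i ≠ 0 → 2 ≤ i ∧ i ≠ 3) :
    2 * padicValNat 2 (gam v) ≤ wt v + deg v := by
  induction h : v.support.card using Nat.strong_induction_on generalizing v with
  | _ c ih =>
    rcases eq_or_ne v 0 with rfl | h0
    · simp
    · obtain ⟨i, hi⟩ := Finsupp.ne_iff.mp h0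
      have hi' : v i ≠ 0 := hi
      have hlt : (v.erase i).support.card < c := by
        rw [← h, Finsupp.support_erase]
        exact Finset.card_erase_lt_of_mem (Finsupp.mem_support_iff.mpr hi')
      have h1 := ih _ hlt (v.erase i) (fun j hj => hv j fun h => hj (by
        by_cases hji : j = i
        · simp [hji]
        · rw [Finsupp.erase_ne hji, h])) rfl
      have h2 := two_mul_part_val_add_two_le (hv i hi').1 (hv i hi').2 hi'
      rw [padicValNat_gam i, wt_eq_add_erase i v, deg_eq_add_erase i v]
      omega

theorem erase_ne_zero_imp {i j : ℕ} {v : ℕ →₀ ℕ} (h : v.erase i j ≠ 0) : v j ≠ 0 ∧ j ≠ i := by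
  by_cases hji : j = i
  · simp [hji] at h
  · rw [Finsupp.erase_ne hji] at h; exact ⟨h, hji⟩

theorem two_mul_padicValNat_gam_add_two_le {v : ℕ →₀ ℕ} (hv : ∀ i, v i ≠ 0 → 2 ≤ i ∧ i ≠ 3)
    (h0 : v ≠ 0) : 2 * padicValNat 2 (gam v) + 2 ≤ wt v + deg v := by
  obtain ⟨i, hi⟩ := Finsupp.ne_iff.mp h0
  have hi' : v i ≠ 0 := hi
  have h1 := two_mul_padicValNat_gam_le (v.erase i) fun j hj => hv j (erase_ne_zero_imp hj).1
  have h2 := two_mul_part_val_add_two_le (hv i hi').1 (hv i hi').2 hi'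
  rw [padicValNat_gam i, wt_eq_add_erase i v, deg_eq_add_erase i v]
  omega

theorem eq_single_of_erase_eq_zero {i : ℕ} {v : ℕ →₀ ℕ} (h : v.erase i = 0) :
    v = single i (v i) := by
  have := Finsupp.single_add_erase i v
  rw [h, add_zero] at this
  exact this.symm

theorem two_mul_padicValNat_gam_add_four_le {v : ℕ →₀ ℕ}
    (hv : ∀ i, v i ≠ 0 → 2 ≤ i ∧ i ≠ 3) (h0 : v ≠ 0) (hA : wt v + deg v ≤ 9)
    (h2 : v ≠ single 2 1) (h7 : v ≠ single 7 1) :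
    2 * padicValNat 2 (gam v) + 4 ≤ wt v + deg v := by
  have hv7 : v 7 = 0 := by
    by_contra hne
    have e1 := wt_eq_add_erase 7 v
    have e2 := deg_eq_add_erase 7 v
    have h71 : v 7 = 1 := by omega
    by_cases he : v.erase 7 = 0
    · exact h7 (by rw [eq_single_of_erase_eq_zero he, h71])
    · obtain ⟨i, hi⟩ := Finsupp.ne_iff.mp he
      have hi' : v.erase 7 i ≠ 0 := hi
      have := (hv i (erase_ne_zero_imp hi').1).1
      have e3 := wt_eq_add_erase i (v.erase 7)
      have : i * 1 ≤ i * (v.erase 7) i := Nat.mul_le_mul_left i (by omega)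
      omega
  have main : ∀ i, v i ≠ 0 → (i = 2 → v i ≠ 1) →
      2 * padicValNat 2 (gam v) + 4 ≤ wt v + deg v := by
    intro i hi' h21
    have h1 := two_mul_padicValNat_gam_le (v.erase i) fun j hj => hv j (erase_ne_zero_imp hj).1
    have h2 := two_mul_part_val_add_four_le (hv i hi').1 (hv i hi').2
      (fun h => hi' (h ▸ hv7)) hi' h21
    rw [padicValNat_gam i, wt_eq_add_erase i v, deg_eq_add_erase i v]
    omega
  by_cases he : v.erase 2 = 0
  · have e := eq_single_of_erase_eq_zero he
    refine main 2 (fun h => h0 (by rw [e, h, single_zero])) (fun _ h => h2 (by rw [e, h]))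
  · obtain ⟨i, hi⟩ := Finsupp.ne_iff.mp he
    have := erase_ne_zero_imp hi
    exact main i this.1 (fun h => absurd h this.2)

/-- The partitions without parts `1` for which the general valuation estimate fails. -/
def IsExceptional (v : ℕ →₀ ℕ) : Prop :=
  v = single 2 1 ∨ v = single 7 1 ∨ v = single 3 1 + single 2 1 ∨ v = single 3 2 + single 2 1 ∨
    v = single 3 1 ∨ v = single 3 2 ∨ v = single 3 3 ∨ v = single 3 4 ∨ v = single 3 5 ∨
    v = single 3 6 ∨ v = single 3 8

theorem padicValNat_gam_erase_three (v : ℕ →₀ ℕ) :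
    padicValNat 2 (gam v) = 2 * v 3 + padicValNat 2 (v 3).factorial
      + padicValNat 2 (gam (v.erase 3)) := by
  rw [padicValNat_gam 3, show 3 + 1 = 2 ^ 2 by norm_num, padicValNat.prime_pow]
  ring

theorem erase_three_parts {v : ℕ →₀ ℕ} (hv : ∀ i, v i ≠ 0 → 2 ≤ i) :
    ∀ i, v.erase 3 i ≠ 0 → 2 ≤ i ∧ i ≠ 3 := fun i hi =>
  ⟨hv i (erase_ne_zero_imp hi).1, (erase_ne_zero_imp hi).2⟩

theorem padicValNat_gam_add_log_lt {v : ℕ →₀ ℕ} {s ε : ℕ} (hv : ∀ i, v i ≠ 0 → 2 ≤ i)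
    (h0 : v ≠ 0) (hs : wt v + deg v = 2 * (s + 1) + ε) (hε : ε ≤ 1) (hE : ¬ IsExceptional v) :
    padicValNat 2 (gam v) + Nat.log 2 s + 1 ≤ s + padicValNat 2 s.factorial := by
  have hv' := erase_three_parts hv
  have e1 := wt_eq_add_erase 3 v
  have e2 := deg_eq_add_erase 3 v
  rw [padicValNat_gam_erase_three]
  have e3 := Finsupp.single_add_erase 3 v
  generalize hv3 : v 3 = j at *
  by_cases he : v.erase 3 = 0
  · rw [he] at e1 e2 e3 ⊢
    rw [add_zero] at e3
    simp only [wt_zero, deg_zero, gam_zero, padicValNat_one_right] at e1 e2 ⊢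
    have hj : j ≠ 0 := by rintro rfl; exact h0 (by rw [← e3, single_zero])
    obtain rfl : s = 2 * j - 1 := by omega
    have := log_lt_factorial_two_mul_sub_one (j := j) (by
      by_contra hcon
      refine hE ?_
      rw [← e3]
      have : j ≤ 8 := by omega
      interval_cases j <;> simp_all [IsExceptional])
    omega
  · have g2 := two_mul_padicValNat_gam_add_two_le hv' he
    by_cases h2 : v.erase 3 = single 2 1
    · rw [h2] at e1 e2 e3 g2 ⊢
      have w2 : wt (single 2 1) = 2 := by simp [wt]
      have d2 : deg (single 2 1) = 1 := by simp [deg]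
      have hj : 3 ≤ j := by
        by_contra hcon
        refine hE ?_
        rw [← e3]
        have : j ≤ 2 := by omega
        interval_cases j <;> simp [IsExceptional]
      obtain rfl : s = 2 * j := by omega
      have := log_lt_factorial_two_mul hj
      omega
    by_cases h7 : v.erase 3 = single 7 1
    · rw [h7] at e1 e2 e3 g2 ⊢
      have w2 : wt (single 7 1) = 7 := by simp [wt]
      have d2 : deg (single 7 1) = 1 := by simp [deg]
      have hj : 1 ≤ j := by
        by_contra hcon
        refine hE ?_
        rw [← e3]
        obtain rfl : j = 0 := by omega
        simp [IsExceptional]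
      obtain rfl : s = 2 * j + 3 := by omega
      have := log_lt_factorial_two_mul_add_three hj
      omega
    by_cases hA : wt (v.erase 3) + deg (v.erase 3) ≤ 9
    · have g4 := two_mul_padicValNat_gam_add_four_le hv' he hA h2 h7
      have := log_le_factorial_of_two_mul_add_one_le (j := j) (s := s) (by omega)
      omega
    · have := log_lt_factorial_of_two_mul_add_four_le (j := j) (s := s) (by omega)
      omega

theorem padicValNat_gam_add_le {v : ℕ →₀ ℕ} {s ε N : ℕ} (hv : ∀ i, v i ≠ 0 → 2 ≤ i)
    (hs : wt v + deg v = 2 * (s + 1) + ε) (hε : ε ≤ 1) (hN : 2 ≤ N)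
    (hm : 2 * N + 1 + s < wt v) (hm12 : 12 + s < wt v) :
    padicValNat 2 (gam v) + N + 1 ≤ s + padicValNat 2 s.factorial := by
  have hv' := erase_three_parts hv
  have e1 := wt_eq_add_erase 3 v
  have e2 := deg_eq_add_erase 3 v
  rw [padicValNat_gam_erase_three]
  generalize hv3 : v 3 = j at *
  by_cases he : v.erase 3 = 0
  · rw [he] at e1 e2 ⊢
    simp only [wt_zero, deg_zero, gam_zero, padicValNat_one_right] at e1 e2 ⊢
    have := add_le_padicValNat_two_factorial_two_mul_sub_one (j := j) (N := N)
      (by omega) (by omega)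
    obtain rfl : s = 2 * j - 1 := by omega
    omega
  · have g2 := two_mul_padicValNat_gam_add_two_le hv' he
    obtain ⟨i, hi⟩ := Finsupp.ne_iff.mp he
    have hi' : v.erase 3 i ≠ 0 := hi
    have e3 := deg_eq_add_erase i (v.erase 3)
    have := add_le_padicValNat_two_factorial (j := j) (s := s) (N := N) hN (by omega)
    omega

theorem two_pow_dvd_two_pow_log_mul_choose {N l s j : ℕ} (hl : 2 ^ N ∣ l) (hj : 1 ≤ j)
    (hjs : j ≤ s) : 2 ^ N ∣ 2 ^ Nat.log 2 s * l.choose j := by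
  rcases Nat.eq_zero_or_pos l with rfl | hl0
  · rw [Nat.choose_eq_zero_of_lt hj]; simp
  have h1 : l * (l - 1).choose (j - 1) = l.choose j * j := by
    have := Nat.add_one_mul_choose_eq (l - 1) (j - 1)
    rwa [Nat.sub_add_cancel hl0, Nat.sub_add_cancel hj] at this
  obtain ⟨e, o, ho, he⟩ := Nat.exists_eq_two_pow_mul_odd (by omega : j ≠ 0)
  have h2 : 2 ^ N ∣ 2 ^ e * l.choose j := by
    refine (Nat.Coprime.pow_left N ho.coprime_two_left).dvd_of_dvd_mul_right
      ((hl.mul_right _).trans (dvd_of_eq (h1.trans ?_)))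
    rw [he]; ring
  have hes : e ≤ Nat.log 2 s := Nat.le_log_of_pow_le (by norm_num)
    ((Nat.le_mul_of_pos_right _ ho.pos).trans (he ▸ hjs))
  exact h2.trans (mul_dvd_mul_right (pow_dvd_pow 2 hes) _)

theorem exists_choose_add_eq {N l : ℕ} (hl : 2 ^ N ∣ l) (M s : ℕ) :
    ∃ c, (M + l).choose s = M.choose s + c ∧ 2 ^ N ∣ 2 ^ Nat.log 2 s * c := by
  rw [Nat.add_choose_eq, Finset.Nat.sum_antidiagonal_eq_sum_range_succ_mk, Finset.sum_range_succ]
  refine ⟨∑ i ∈ Finset.range s, M.choose i * l.choose (s - i), ?_, ?_⟩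
  · simp [add_comm]
  · rw [Finset.mul_sum]
    refine Finset.dvd_sum fun i hi => ?_
    have hi := Finset.mem_range.mp hi
    rw [mul_left_comm]
    exact (two_pow_dvd_two_pow_log_mul_choose hl (by omega) (by omega)).mul_left _

theorem two_pow_dvd_descFactorial_sub {N l : ℕ} (hl : 2 ^ N ∣ l) (M s : ℕ) :
    (2 : ℤ) ^ (N + padicValNat 2 s.factorial) ∣
      2 ^ Nat.log 2 s * (((M + l).descFactorial s : ℤ) - M.descFactorial s) := by
  obtain ⟨c, hc, hd⟩ := exists_choose_add_eq hl M s
  rw [Nat.descFactorial_eq_factorial_mul_choose, Nat.descFactorial_eq_factorial_mul_choose, hc]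
  have h1 : 2 ^ padicValNat 2 s.factorial ∣ s.factorial := pow_padicValNat_dvd
  have h2 := mul_dvd_mul hd h1
  rw [← pow_add] at h2
  have h3 : ((2 ^ (N + padicValNat 2 s.factorial) : ℕ) : ℤ) ∣ _ := Int.natCast_dvd_natCast.mpr h2
  push_cast at h3 ⊢
  exact h3.trans (dvd_of_eq (by ring))

theorem natCast_descFactorial_eq_prod (M s : ℕ) :
    (M.descFactorial s : ℤ) = ∏ i ∈ Finset.range s, ((M : ℤ) - i) := by
  induction s with
  | zero => simp
  | succ s ih =>
    rw [Nat.descFactorial_succ, Finset.prod_range_succ, ← ih]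
    rcases Nat.lt_or_ge M s with h | h
    · simp [Nat.descFactorial_of_lt h]
    · push_cast [h]; ring

theorem odd_mul_block_sub {N k l M s ε g : ℕ} (hN : 3 ≤ N) (hl : l = k * 2 ^ N)
    (h : (2 : ℤ) ^ g ∣ 2 ^ s * (M + l).descFactorial s) :
    (2 : ℤ) ^ (N + 1 + g) ∣
      2 ^ s * (((M + l).descFactorial s * oddProd (M + l + ε) : ℤ)
        - M.descFactorial s * oddProd (M + ε))
      - 2 ^ s * oddProd (M + ε) * (((M + l).descFactorial s : ℤ) - M.descFactorial s) := by
  have h1 := two_pow_dvd_oddBlock_sub_one N k hN ((M + ε : ℕ) : ℤ)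
  rw [← hl] at h1
  have h2 := oddProd_add (M + ε) l
  rw [show M + l + ε = M + ε + l by ring, h2, pow_add]
  exact ((mul_dvd_mul h1 h).mul_left (oddProd (M + ε) : ℤ)).trans (dvd_of_eq (by ring))

theorem two_pow_dvd_term_sub {N k l M s ε g : ℕ} (hN : 3 ≤ N) (hl : l = k * 2 ^ N)
    (h : (2 : ℤ) ^ g ∣ 2 ^ s * (M + l).descFactorial s)
    (h' : (2 : ℤ) ^ (N + 1 + g) ∣ 2 ^ s * (((M + l).descFactorial s : ℤ) - M.descFactorial s)) :
    (2 : ℤ) ^ (N + 1 + g) ∣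
      2 ^ s * (((M + l).descFactorial s * oddProd (M + l + ε) : ℤ)
        - M.descFactorial s * oddProd (M + ε)) := by
  have := dvd_add (odd_mul_block_sub (ε := ε) hN hl h) (h'.mul_left (oddProd (M + ε) : ℤ))
  exact this.trans (dvd_of_eq (by ring))

theorem two_pow_dvd_two_pow_mul_descFactorial {a s : ℕ}
    (h : a ≤ s + padicValNat 2 s.factorial) (q : ℕ) :
    (2 : ℤ) ^ a ∣ 2 ^ s * q.descFactorial s := by
  have h1 : 2 ^ padicValNat 2 s.factorial ∣ s.factorial := pow_padicValNat_dvd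
  have h2 := mul_dvd_mul_left (2 ^ s) (h1.trans (Nat.factorial_dvd_descFactorial q s))
  rw [← pow_add] at h2
  exact_mod_cast (pow_dvd_pow 2 h).trans h2

theorem two_pow_dvd_term_sub_of_log {N k l M s ε g : ℕ} (hN : 3 ≤ N) (hl : l = k * 2 ^ N)
    (h : g + Nat.log 2 s + 1 ≤ s + padicValNat 2 s.factorial) :
    (2 : ℤ) ^ (N + 1 + g) ∣
      2 ^ s * (((M + l).descFactorial s * oddProd (M + l + ε) : ℤ)
        - M.descFactorial s * oddProd (M + ε)) := by
  refine two_pow_dvd_term_sub hN hl (two_pow_dvd_two_pow_mul_descFactorial (by omega) _) ?_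
  have h1 := two_pow_dvd_descFactorial_sub (Dvd.intro_left k hl.symm) M s
  have h2 := mul_dvd_mul_left ((2 : ℤ) ^ s) h1
  rw [← pow_add, mul_left_comm] at h2
  refine (mul_dvd_mul_iff_left (pow_ne_zero (Nat.log 2 s) (two_ne_zero' ℤ))).mp
    (Dvd.dvd.trans ?_ h2)
  rw [← pow_add]
  exact pow_dvd_pow 2 (by omega)

/-- If `∏ (8y + c - i)` agrees with an affine function of `y` up to a multiple of `d`, then so does
its difference along a step of `8`-multiples. -/
theorem dvd_descFactorial_sub_of_eval {s M l : ℕ} {t c c₀ a d Λ : ℤ} (G : Polynomial ℤ)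
    (hG : ∀ y : ℤ, ∏ i ∈ Finset.range s, (8 * y + c - i) = c₀ + a * y + d * G.eval y)
    (hM : (M : ℤ) = 8 * t + c) (hl : (l : ℤ) = 8 * Λ) :
    d * Λ ∣ ((M + l).descFactorial s : ℤ) - M.descFactorial s - a * Λ := by
  have h1 := Polynomial.sub_dvd_eval_sub (t + Λ) t G
  rw [add_sub_cancel_left] at h1
  have e1 := hG t
  have e2 := hG (t + Λ)
  rw [natCast_descFactorial_eq_prod, natCast_descFactorial_eq_prod, Nat.cast_add, hM, hl, e1,
    show 8 * t + c + 8 * Λ = 8 * (t + Λ) + c by ring, e2]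
  exact (mul_dvd_mul_left d h1).trans (dvd_of_eq (by ring))

theorem oddProd_eight_mul_add_two (t : ℕ) : (8 : ℤ) ∣ oddProd (8 * t + 2) - 3 := by
  have h := oddProd_eight_mul_add_four t
  rw [oddProd_succ, oddProd_succ] at h
  push_cast at h
  have e : (oddProd (8 * t + 2) : ℤ) * (2 * (8 * t + 2) + 1) * (2 * (8 * t + 2 + 1) + 1) =
    3 * oddProd (8 * t + 2) + 8 * (oddProd (8 * t + 2) * (32 * t ^ 2 + 24 * t + 4)) := by ring
  generalize (oddProd (8 * t + 2) : ℤ) * (32 * t ^ 2 + 24 * t + 4) = z at e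
  have e' : (8 * (t : ℤ) + 3) = 8 * t + 2 + 1 := by ring
  rw [e'] at h
  rw [e] at h
  omega

theorem oddProd_eight_mul_add_one (t : ℕ) : (8 : ℤ) ∣ oddProd (8 * t + 1) - 1 := by
  have h := oddProd_eight_mul_add_two t
  rw [oddProd_succ] at h
  push_cast at h
  have e : (oddProd (8 * t + 1) : ℤ) * (2 * (8 * t + 1) + 1) =
    3 * oddProd (8 * t + 1) + 8 * (oddProd (8 * t + 1) * (2 * t)) := by ring
  rw [e] at h
  generalize (oddProd (8 * t + 1) : ℤ) * (2 * t) = z at h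
  omega

theorem oddProd_eight_mul_add_seven (t : ℕ) : (8 : ℤ) ∣ oddProd (8 * t + 7) + 1 := by
  have h := oddProd_eight_mul_add_one (t + 1)
  rw [show 8 * (t + 1) + 1 = 8 * t + 7 + 1 + 1 by ring, oddProd_succ, oddProd_succ] at h
  push_cast at h
  have e : (oddProd (8 * t + 7) : ℤ) * (2 * (8 * t + 7) + 1) * (2 * (8 * t + 8) + 1) =
    8 * (oddProd (8 * t + 7) * (32 * t ^ 2 + 64 * t + 32)) - oddProd (8 * t + 7) := by ring
  rw [e] at h
  generalize (oddProd (8 * t + 7) : ℤ) * (32 * t ^ 2 + 64 * t + 32) = z at h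
  omega

theorem two_pow_dvd_leading_term {N k l m t : ℕ} (hN : 3 ≤ N) (hl : l = k * 2 ^ N)
    (hm : m = 8 * t + 4) :
    (2 : ℤ) ^ (N + 6) ∣ (m + l) * oddProd (m - 1) - m * oddProd (m + l - 1) + l
      - 2 * l * m * (m + l) := by
  have e1 : (oddProd m : ℤ) = oddProd (m - 1) * (2 * m - 1) := by
    rw [hm, show 8 * t + 4 - 1 = 8 * t + 3 by omega, oddProd_succ]; push_cast; ring
  have e2 : (oddProd (m + l) : ℤ) = oddProd (m + l - 1) * (2 * (m + l) - 1) := by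
    conv_lhs => rw [show m + l = m + l - 1 + 1 by omega, oddProd_succ]
    push_cast [show 1 ≤ m + l by omega]; ring
  have e3 := oddProd_add m l
  obtain ⟨q, hq⟩ := two_pow_dvd_oddBlock_mul_sub N k hN (2 * t + 1)
  rw [← hl, show (8 : ℤ) * (2 * t + 1) = 2 * (m : ℕ) by rw [hm]; push_cast; ring,
    sub_eq_iff_eq_add] at hq
  obtain ⟨z, hz⟩ := oddProd_eight_mul_add_four t
  rw [← hm, sub_eq_iff_eq_add] at hz
  rw [hq, e2, e1] at e3
  rw [e1] at hz
  have hodd : Odd ((2 * (m : ℤ) - 1) * (2 * (m + l) - 1)) := by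
    refine Odd.mul ⟨m - 1, by ring⟩ ⟨m + l - 1, by ring⟩
  refine (isCoprime_two_pow_of_odd hodd (N + 6)).dvd_of_dvd_mul_right ?_
  generalize (oddProd (m + l - 1) : ℤ) = b at *
  generalize (oddProd (m - 1) : ℤ) = a at *
  obtain ⟨r, rfl⟩ := Nat.exists_eq_add_of_le hN
  have hL : (l : ℤ) = 8 * (k * 2 ^ r) := by rw [hl]; push_cast; ring
  have hM : (m : ℤ) = 8 * t + 4 := by rw [hm]; push_cast; ring
  rw [hL, hM] at e3 ⊢
  rw [hM] at hz
  refine ⟨k * ((-416) * t * z + (-82) * z + 32 * (k * 2 ^ r) * z + (-512) * t ^ 2 * z + (-6550) * t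
      ^ 2 + (-1624) * t + (-250) * t * (k * 2 ^ r) + (-7680) * t ^ 3 + (-91) + (-77) * (k * 2 ^ r)
      + (-512) * t ^ 4 + (-1024) * t ^ 3 * (k * 2 ^ r) + (-1440) * t ^ 2 * (k * 2 ^ r) + (-512) * t
      ^ 2 * (k * 2 ^ r) ^ 2 + (-480) * t * (k * 2 ^ r) ^ 2 + (-112) * (k * 2 ^ r) ^ 2) - (2 * t +
      1) * (2 * (8 * t + 4) - 1) * (a * (2 * (8 * t + 4) - 1)) * q, ?_⟩
  linear_combination (-(8 * (t : ℤ) + 4) * (2 * (8 * t + 4) - 1)) * e3 +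
    (8 * ((k : ℤ) * 2 ^ r)) * (2 * (2 * (8 * t + 4) + 8 * (k * 2 ^ r)) - 1
      - 2 * (8 * t + 4) * (2 * (8 * t + 4) - 1)) * hz

theorem two_pow_dvd_term_sub_of_eval {N k l M s e g : ℕ} {t c c₀ : ℤ} (hN : 3 ≤ N)
    (hl : l = k * 2 ^ N) (hM : (M : ℤ) = 8 * t + c) (G : Polynomial ℤ)
    (hG : ∀ y : ℤ, ∏ i ∈ Finset.range s, (8 * y + c - i) = c₀ + 2 ^ e * G.eval y)
    (hg : g + 4 ≤ e + s) (hgs : 2 ^ g ∣ 2 ^ s * s.factorial) :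
    (2 : ℤ) ^ (N + 1 + g) ∣ 2 ^ s * (((M + l).descFactorial s * oddProd (M + l) : ℤ)
      - M.descFactorial s * oddProd M) := by
  obtain ⟨r, rfl⟩ := Nat.exists_eq_add_of_le hN
  have hL : (l : ℤ) = 8 * (k * 2 ^ r) := by rw [hl]; push_cast; ring
  refine two_pow_dvd_term_sub (ε := 0) hN hl ?_ ?_
  · exact_mod_cast hgs.trans (mul_dvd_mul_left _ (Nat.factorial_dvd_descFactorial _ s))
  · have h := dvd_descFactorial_sub_of_eval (a := 0) (c₀ := c₀) (d := 2 ^ e) G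
      (fun y => by rw [hG]; ring) hM hL
    rw [zero_mul, sub_zero] at h
    refine Dvd.dvd.trans ?_ (mul_dvd_mul_left ((2 : ℤ) ^ s) h)
    rw [show (2 : ℤ) ^ s * (2 ^ e * (k * 2 ^ r)) = 2 ^ (s + e + r) * k by ring]
    exact (pow_dvd_pow 2 (by omega)).mul_right _

theorem two_pow_dvd_term_sub_three {N k l M : ℕ} {t : ℤ} (hN : 3 ≤ N) (hl : l = k * 2 ^ N)
    (hM : (M : ℤ) = 8 * t + 0) :
    (2 : ℤ) ^ (N + 1 + 3) ∣ 2 ^ 3 * (((M + l).descFactorial 3 * oddProd (M + l) : ℤ)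
      - M.descFactorial 3 * oddProd M) := by
  refine two_pow_dvd_term_sub_of_eval (e := 4) (c₀ := 0) hN hl hM
    (Polynomial.C 1 * Polynomial.X ^ 1 - Polynomial.C 12 * Polynomial.X ^ 2 + Polynomial.C 32
      * Polynomial.X ^ 3)
    (fun y => ?_) (by norm_num) (by decide)
  simp only [Finset.prod_range_succ, Finset.prod_range_zero, Polynomial.eval_add,
      Polynomial.eval_sub,
    Polynomial.eval_mul, Polynomial.eval_pow, Polynomial.eval_C, Polynomial.eval_X]
  push_cast
  ring

theorem two_pow_dvd_term_sub_five {N k l M : ℕ} {t : ℤ} (hN : 3 ≤ N) (hl : l = k * 2 ^ N)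
    (hM : (M : ℤ) = 8 * t + 0) :
    (2 : ℤ) ^ (N + 1 + 7) ∣ 2 ^ 5 * (((M + l).descFactorial 5 * oddProd (M + l) : ℤ)
      - M.descFactorial 5 * oddProd M) := by
  refine two_pow_dvd_term_sub_of_eval (e := 6) (c₀ := 0) hN hl hM
    (Polynomial.C 3 * Polynomial.X ^ 1 - Polynomial.C 50 * Polynomial.X ^ 2 + Polynomial.C 280
      * Polynomial.X ^ 3 - Polynomial.C 640 * Polynomial.X ^ 4 + Polynomial.C 512 *
      Polynomial.X ^ 5)
    (fun y => ?_) (by norm_num) (by decide)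
  simp only [Finset.prod_range_succ, Finset.prod_range_zero, Polynomial.eval_add,
      Polynomial.eval_sub,
    Polynomial.eval_mul, Polynomial.eval_pow, Polynomial.eval_C, Polynomial.eval_X]
  push_cast
  ring

theorem two_pow_dvd_term_sub_nine {N k l M : ℕ} {t : ℤ} (hN : 3 ≤ N) (hl : l = k * 2 ^ N)
    (hM : (M : ℤ) = 8 * t + (-2)) :
    (2 : ℤ) ^ (N + 1 + 13) ∣ 2 ^ 9 * (((M + l).descFactorial 9 * oddProd (M + l) : ℤ)
      - M.descFactorial 9 * oddProd M) := by
  refine two_pow_dvd_term_sub_of_eval (e := 8) (c₀ := -3628800) hN hl hM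
    (Polynomial.C 218745 * Polynomial.X ^ 1 - Polynomial.C 1438434 * Polynomial.X ^ 2 +
      Polynomial.C 5311528 * Polynomial.X ^ 3 - Polynomial.C 12178656 * Polynomial.X ^ 4 +
      Polynomial.C 18033792 * Polynomial.X ^ 5 - Polynomial.C 17289216 * Polynomial.X ^ 6 +
      Polynomial.C 10371072 * Polynomial.X ^ 7 - Polynomial.C 3538944 * Polynomial.X ^ 8 +
      Polynomial.C 524288 * Polynomial.X ^ 9)
    (fun y => ?_) (by norm_num) (by decide)
  simp only [Finset.prod_range_succ, Finset.prod_range_zero, Polynomial.eval_add,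
      Polynomial.eval_sub,
    Polynomial.eval_mul, Polynomial.eval_pow, Polynomial.eval_C, Polynomial.eval_X]
  push_cast
  ring

theorem two_pow_dvd_term_sub_eleven {N k l M : ℕ} {t : ℤ} (hN : 3 ≤ N) (hl : l = k * 2 ^ N)
    (hM : (M : ℤ) = 8 * t + (-3)) :
    (2 : ℤ) ^ (N + 1 + 16) ∣ 2 ^ 11 * (((M + l).descFactorial 11 * oddProd (M + l) : ℤ)
      - M.descFactorial 11 * oddProd M) := by
  refine two_pow_dvd_term_sub_of_eval (e := 9) (c₀ := -3113510400) hN hl hM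
    (Polynomial.C 81736155 * Polynomial.X ^ 1 - Polynomial.C 486866556 * Polynomial.X ^ 2 +
      Polynomial.C 1698920916 * Polynomial.X ^ 3 - Polynomial.C 3864034240 * Polynomial.X ^ 4 +
      Polynomial.C 6021920960 * Polynomial.X ^ 5 - Polynomial.C 6569299968 * Polynomial.X ^ 6 +
      Polynomial.C 5021626368 * Polynomial.X ^ 7 - Polynomial.C 2638479360 * Polynomial.X ^ 8 +
      Polynomial.C 908328960 * Polynomial.X ^ 9 - Polynomial.C 184549376 * Polynomial.X ^ 10 +
      Polynomial.C 16777216 * Polynomial.X ^ 11)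
    (fun y => ?_) (by norm_num) (by decide)
  simp only [Finset.prod_range_succ, Finset.prod_range_zero, Polynomial.eval_add,
      Polynomial.eval_sub,
    Polynomial.eval_mul, Polynomial.eval_pow, Polynomial.eval_C, Polynomial.eval_X]
  push_cast
  ring

theorem two_pow_dvd_term_sub_fifteen {N k l M : ℕ} {t : ℤ} (hN : 3 ≤ N) (hl : l = k * 2 ^ N)
    (hM : (M : ℤ) = 8 * t + (-5)) :
    (2 : ℤ) ^ (N + 1 + 23) ∣ 2 ^ 15 * (((M + l).descFactorial 15 * oddProd (M + l) : ℤ)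
      - M.descFactorial 15 * oddProd M) := by
  refine two_pow_dvd_term_sub_of_eval (e := 12) (c₀ := -5068545850368000) hN hl hM
    (Polynomial.C 14496895694925 * Polynomial.X ^ 1 - Polynomial.C 78183656112105 *
      Polynomial.X ^ 2 + Polynomial.C 257596598046978 * Polynomial.X ^ 3 - Polynomial.C
      580087776122400 * Polynomial.X ^ 4 + Polynomial.C 946116587765440 * Polynomial.X ^ 5 -
      Polynomial.C 1154988506031360 * Polynomial.X ^ 6 + Polynomial.C 1075020854043136 *
      Polynomial.X ^ 7 - Polynomial.C 769433621299200 * Polynomial.X ^ 8 + Polynomial.C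
      423627447992320 * Polynomial.X ^ 9 - Polynomial.C 178005831843840 * Polynomial.X ^ 10 +
      Polynomial.C 56077051756544 * Polynomial.X ^ 11 - Polynomial.C 12824503910400 *
      Polynomial.X ^ 12 + Polynomial.C 2010581565440 * Polynomial.X ^ 13 - Polynomial.C
      193273528320 * Polynomial.X ^ 14 + Polynomial.C 8589934592 * Polynomial.X ^ 15)
    (fun y => ?_) (by norm_num) (by decide)
  simp only [Finset.prod_range_succ, Finset.prod_range_zero, Polynomial.eval_add,
      Polynomial.eval_sub,
    Polynomial.eval_mul, Polynomial.eval_pow, Polynomial.eval_C, Polynomial.eval_X]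
  push_cast
  ring

theorem two_pow_dvd_term_single_three_one {N k l M t : ℕ} (hN : 3 ≤ N) (hl : l = k * 2 ^ N)
    (hM : M = 8 * t + 2) :
    (2 : ℤ) ^ (N + 1 + 2) ∣ 2 ^ 1 * (((M + l).descFactorial 1 * oddProd (M + l) : ℤ)
      - M.descFactorial 1 * oddProd M) + 2 * l := by
  obtain ⟨z, hz⟩ := oddProd_eight_mul_add_two t
  obtain ⟨r, rfl⟩ := Nat.exists_eq_add_of_le hN
  have hL : (l : ℤ) = 2 ^ 3 * 2 ^ r * k := by rw [hl]; push_cast; ring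
  have h := odd_mul_block_sub (M := M) (s := 1) (ε := 0) (g := 2) hN hl
    ⟨4 * t + 1 + 4 * 2 ^ r * k, by rw [hM, hl, Nat.descFactorial_one]; push_cast; ring⟩
  rw [← hM] at hz
  refine (dvd_iff_dvd_of_dvd_sub (h.trans (dvd_of_eq ?_))).mpr
    (⟨k * (2 * z + 1), ?_⟩ : _ ∣ (2 : ℤ) * l * (oddProd M + 1))
  · simp only [Nat.descFactorial_one, add_zero]; push_cast; ring
  · rw [hL]; linear_combination (2 * (2 ^ 3 * 2 ^ r * (k : ℤ))) * hz

theorem two_pow_dvd_term_single_three_two {N k l M t : ℕ} (hN : 3 ≤ N) (hl : l = k * 2 ^ N)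
    (hM : M = 8 * t + 1) :
    (2 : ℤ) ^ (N + 1 + 5) ∣ 2 ^ 3 * (((M + l).descFactorial 3 * oddProd (M + l) : ℤ)
      - M.descFactorial 3 * oddProd M) + 8 * l := by
  obtain ⟨z, hz⟩ := oddProd_eight_mul_add_one t
  obtain ⟨r, rfl⟩ := Nat.exists_eq_add_of_le hN
  have hL : (l : ℤ) = 8 * (2 ^ r * k) := by rw [hl]; push_cast; ring
  have hM' : (M : ℤ) = 8 * t + 1 := by rw [hM]; push_cast; ring
  have h := odd_mul_block_sub (M := M) (s := 3) (ε := 0) (g := 5) hN hl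
    ⟨2 * (t + 2 ^ r * k) * (M + l) * (M + l - 2), by
      rw [natCast_descFactorial_eq_prod]
      simp only [Finset.prod_range_succ, Finset.prod_range_zero]
      push_cast
      rw [hL, hM']; ring⟩
  obtain ⟨q, hq⟩ := dvd_descFactorial_sub_of_eval (s := 3) (c₀ := 0) (a := -8) (d := 512)
    (Polynomial.X ^ 3) (fun y => by
      simp only [Finset.prod_range_succ, Finset.prod_range_zero, Polynomial.eval_pow,
        Polynomial.eval_X]
      push_cast; ring) hM' hL
  rw [← hM] at hz
  rw [sub_eq_iff_eq_add] at hq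
  rw [hq] at h
  refine (dvd_iff_dvd_of_dvd_sub (h.trans (dvd_of_eq ?_))).mpr
    (⟨oddProd M * q * k * 8 - k * z, ?_⟩ : _ ∣
      (2 : ℤ) ^ 3 * oddProd M * (512 * (2 ^ r * k) * q + -8 * (2 ^ r * k)) + 8 * l)
  · simp only [add_zero]; ring
  · rw [hL]; linear_combination (-64 * (2 ^ r * (k : ℤ))) * hz

theorem two_pow_dvd_term_single_three_four {N k l M t : ℕ} (hN : 3 ≤ N) (hl : l = k * 2 ^ N)
    (hM : M = 8 * t + 7) :
    (2 : ℤ) ^ (N + 1 + 11) ∣ 2 ^ 7 * (((M + l).descFactorial 7 * oddProd (M + l) : ℤ)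
      - M.descFactorial 7 * oddProd M) + 1536 * l := by
  obtain ⟨z, hz⟩ := oddProd_eight_mul_add_seven t
  obtain ⟨r, rfl⟩ := Nat.exists_eq_add_of_le hN
  have hL : (l : ℤ) = 8 * (2 ^ r * k) := by rw [hl]; push_cast; ring
  have hM' : (M : ℤ) = 8 * (t + 1) + (-1) := by rw [hM]; push_cast; ring
  have hd : 2 ^ 11 ∣ 2 ^ 7 * Nat.factorial 7 := by decide
  have h := odd_mul_block_sub (M := M) (s := 7) (ε := 0) (g := 11) hN hl
    (by exact_mod_cast hd.trans (mul_dvd_mul_left _ (Nat.factorial_dvd_descFactorial _ 7)))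
  obtain ⟨q, hq⟩ := dvd_descFactorial_sub_of_eval (s := 7) (c₀ := -5040) (a := 104544) (d := 256)
    (0 - Polynomial.C 3283 * Polynomial.X ^ 2 + Polynomial.C 13538 * Polynomial.X ^ 3 -
      Polynomial.C 31360 * Polynomial.X ^ 4 + Polynomial.C 41216 * Polynomial.X ^ 5 -
      Polynomial.C 28672 * Polynomial.X ^ 6 + Polynomial.C 8192 * Polynomial.X ^ 7)
    (fun y => by
      simp only [Finset.prod_range_succ, Finset.prod_range_zero, Polynomial.eval_add,
        Polynomial.eval_sub, Polynomial.eval_zero, Polynomial.eval_mul, Polynomial.eval_pow,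
        Polynomial.eval_C, Polynomial.eval_X]
      push_cast; ring) hM' hL
  rw [← hM] at hz
  rw [sub_eq_iff_eq_add] at hq
  rw [hq] at h
  refine (dvd_iff_dvd_of_dvd_sub (h.trans (dvd_of_eq ?_))).mpr
    (⟨oddProd M * q * k + 3267 * k * z - 408 * k, ?_⟩ : _ ∣
      (2 : ℤ) ^ 7 * oddProd M * (256 * (2 ^ r * k) * q + 104544 * (2 ^ r * k)) + 1536 * l)
  · simp only [add_zero]; ring
  · rw [hL]; linear_combination (13381632 * (2 ^ r * (k : ℤ))) * hz

theorem two_pow_dvd_term_three_two {N k l M t : ℕ} (hN : 3 ≤ N) (hl : l = k * 2 ^ N)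
    (hM : M = 8 * t + 1) :
    (2 : ℤ) ^ (N + 1 + 2) ∣ 2 ^ 2 * (((M + l).descFactorial 2 * oddProd (M + l + 1) : ℤ)
      - M.descFactorial 2 * oddProd (M + 1)) - 12 * l := by
  obtain ⟨z, hz⟩ := odd_oddProd (M + 1)
  obtain ⟨r, rfl⟩ := Nat.exists_eq_add_of_le hN
  have hL : (l : ℤ) = 8 * (2 ^ r * k) := by rw [hl]; push_cast; ring
  have hM' : (M : ℤ) = 8 * t + 1 := by rw [hM]; push_cast; ring
  have h := odd_mul_block_sub (M := M) (s := 2) (ε := 1) (g := 2) hN hl (Dvd.intro _ rfl)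
  obtain ⟨q, hq⟩ := dvd_descFactorial_sub_of_eval (s := 2) (c₀ := 0) (a := 8) (d := 64)
    (Polynomial.X ^ 2) (fun y => by
      simp only [Finset.prod_range_succ, Finset.prod_range_zero, Polynomial.eval_pow,
        Polynomial.eval_X]
      push_cast; ring) hM' hL
  rw [sub_eq_iff_eq_add] at hq
  rw [hq] at h
  refine (dvd_iff_dvd_of_dvd_sub (h.trans (dvd_of_eq ?_))).mpr
    (⟨oddProd (M + 1) * q * k * 4 + k * z - k, ?_⟩ : _ ∣
      (2 : ℤ) ^ 2 * oddProd (M + 1) * (64 * (2 ^ r * k) * q + 8 * (2 ^ r * k)) - 12 * l)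
  · ring
  · rw [hL, hz]; push_cast; ring

theorem two_pow_dvd_term_three_three_two {N k l M t : ℕ} (hN : 3 ≤ N) (hl : l = k * 2 ^ N)
    (hM : M = 8 * t) :
    (2 : ℤ) ^ (N + 1 + 5) ∣ 2 ^ 4 * (((M + l).descFactorial 4 * oddProd (M + l + 1) : ℤ)
      - M.descFactorial 4 * oddProd (M + 1)) - 96 * l := by
  obtain ⟨z, hz⟩ := odd_oddProd (M + 1)
  obtain ⟨r, rfl⟩ := Nat.exists_eq_add_of_le hN
  have hL : (l : ℤ) = 8 * (2 ^ r * k) := by rw [hl]; push_cast; ring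
  have hM' : (M : ℤ) = 8 * t + 0 := by rw [hM]; push_cast; ring
  have hd : 2 ^ 5 ∣ 2 ^ 4 * Nat.factorial 4 := by decide
  have h := odd_mul_block_sub (M := M) (s := 4) (ε := 1) (g := 5) hN hl
    (by exact_mod_cast hd.trans (mul_dvd_mul_left _ (Nat.factorial_dvd_descFactorial _ 4)))
  obtain ⟨q, hq⟩ := dvd_descFactorial_sub_of_eval (s := 4) (c₀ := 0) (a := -48) (d := 64)
    (Polynomial.C 11 * Polynomial.X ^ 2 - Polynomial.C 48 * Polynomial.X ^ 3 + Polynomial.C 64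
      * Polynomial.X ^ 4) (fun y => by
      simp only [Finset.prod_range_succ, Finset.prod_range_zero, Polynomial.eval_add,
        Polynomial.eval_sub, Polynomial.eval_mul, Polynomial.eval_pow,
        Polynomial.eval_C, Polynomial.eval_X]
      push_cast; ring) hM' hL
  rw [sub_eq_iff_eq_add] at hq
  rw [hq] at h
  refine (dvd_iff_dvd_of_dvd_sub (h.trans (dvd_of_eq ?_))).mpr
    (⟨oddProd (M + 1) * q * k * 2 - 3 * k * z - 3 * k, ?_⟩ : _ ∣
      (2 : ℤ) ^ 4 * oddProd (M + 1) * (64 * (2 ^ r * k) * q + -48 * (2 ^ r * k)) - 96 * l)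
  · ring
  · rw [hL, hz]; push_cast; ring

/-- `x` is `2 ^ t` times a `2`-integral rational number. -/
def TwoPowDvd (t : ℕ) (x : ℚ) : Prop := ∃ a b : ℤ, Odd b ∧ x * b = 2 ^ t * a

theorem TwoPowDvd.le_pval {t : ℕ} {x : ℚ} (h : TwoPowDvd t x) :
    ((t : ℤ) : WithTop ℤ) ≤ pval 2 x := by
  obtain ⟨a, b, hb, he⟩ := h
  unfold pval
  split_ifs with hx
  · exact le_top
  · have hb0 : (b : ℚ) ≠ 0 := by
      rintro h0
      rw [Int.cast_eq_zero] at h0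
      simp [h0] at hb
    have ha0 : (a : ℚ) ≠ 0 := fun h0 => mul_ne_zero hx hb0 (by rw [he, h0, mul_zero])
    have hv := congrArg (padicValRat 2) he
    rw [padicValRat.mul hx hb0, padicValRat.mul (by positivity) ha0, padicValRat.pow,
      padicValRat.of_int, padicValRat.of_int,
      padicValInt.eq_zero_of_not_dvd (fun hd => Int.not_even_iff_odd.mpr hb
        (even_iff_two_dvd.mpr (by exact_mod_cast hd)))] at hv
    have h2 : padicValRat 2 (2 : ℚ) = 1 := by
      exact_mod_cast padicValRat.self (p := 2) (by norm_num)
    rw [h2] at hv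
    rw [WithTop.coe_le_coe]
    push_cast at hv
    omega

theorem twoPowDvd_zero (t : ℕ) : TwoPowDvd t 0 := ⟨0, 1, odd_one, by simp⟩

theorem padicValNat_two_of_eq {g o n : ℕ} (ho : Odd o) (h : n = 2 ^ g * o) :
    padicValNat 2 n = g := by
  rw [h, padicValNat.mul (by positivity) ho.pos.ne', padicValNat.prime_pow,
    padicValNat.eq_zero_of_not_dvd (fun hd => Nat.not_even_iff_odd.mpr ho
      (even_iff_two_dvd.mpr hd)), add_zero]

theorem TwoPowDvd.of_dvd {t G : ℕ} {A : ℤ} (hG : G ≠ 0)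
    (h : (2 : ℤ) ^ (t + padicValNat 2 G) ∣ A) : TwoPowDvd t ((A : ℚ) / G) := by
  obtain ⟨e, o, ho, he⟩ := Nat.exists_eq_two_pow_mul_odd hG
  have hv := padicValNat_two_of_eq ho he
  obtain ⟨q, rfl⟩ := h
  refine ⟨q, o, by exact_mod_cast ho, ?_⟩
  have ho' : (o : ℚ) ≠ 0 := by exact_mod_cast ho.pos.ne'
  rw [hv, he]
  push_cast
  field_simp
  ring

theorem wt_add (u v : ℕ →₀ ℕ) : wt (u + v) = wt u + wt v :=
  Finsupp.sum_add_index' (by simp) fun i a b => by ring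

theorem deg_add (u v : ℕ →₀ ℕ) : deg (u + v) = deg u + deg v :=
  Finsupp.sum_add_index' (by simp) fun i a b => rfl

theorem wt_single (i a : ℕ) : wt (single i a) = i * a := Finsupp.sum_single_index (by simp)

theorem deg_single (i a : ℕ) : deg (single i a) = a := Finsupp.sum_single_index (by simp)

theorem gam_single (i a : ℕ) : gam (single i a) = (i + 1) ^ a * a.factorial :=
  Finsupp.prod_single_index (by simp)

theorem gam_single_add {i : ℕ} (a : ℕ) {v : ℕ →₀ ℕ} (hv : v i = 0) :
    gam (single i a + v) = (i + 1) ^ a * a.factorial * gam v := by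
  rw [gam_eq_mul_erase i, Finsupp.erase_add, Finsupp.erase_single, zero_add,
    Finsupp.erase_of_notMem_support (by simpa using hv), Finsupp.add_apply, hv,
    Finsupp.single_eq_same, add_zero]

theorem deg_ne_zero {v : ℕ →₀ ℕ} (h : v ≠ 0) : deg v ≠ 0 := by
  obtain ⟨i, hi⟩ := Finsupp.ne_iff.mp h
  rw [deg_eq_add_erase i]
  rw [Finsupp.zero_apply] at hi
  omega

theorem tau_single_one_add {v : ℕ →₀ ℕ} {s ε : ℕ} (h : ℕ) (hv : v 1 = 0)
    (hs : wt v + deg v = 2 * (s + 1) + ε) (hε : ε ≤ 1) :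
    tau (single 1 h + v) = (-1) ^ (h + deg v - 1) *
      ((2 ^ s * ((h + s).descFactorial s * oddProd (h + s + ε)) : ℤ) : ℚ) / gam v := by
  have e1 : wt (single 1 h + v) + deg (single 1 h + v) - 2 = 2 * (h + s) + ε := by
    rw [wt_add, deg_add, wt_single, deg_single]; omega
  have e2 : (h + s).factorial = h.factorial * (h + s).descFactorial s := by
    rw [← Nat.factorial_mul_descFactorial (Nat.le_add_left s h), Nat.add_sub_cancel]
  have hg : (gam v : ℚ) ≠ 0 := by exact_mod_cast gam_ne_zero v
  have hf : (h.factorial : ℚ) ≠ 0 := by exact_mod_cast h.factorial_ne_zero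
  rw [tau, e1, factorial_two_mul_add_eq _ _ hε, e2, gam_single_add h hv, deg_add, deg_single]
  push_cast
  rw [pow_add]
  field_simp

theorem tau_single_one (n : ℕ) (hn : 1 ≤ n) :
    tau (single 1 n) = (-1) ^ (n - 1) * (oddProd (n - 1) / (2 * n)) := by
  obtain ⟨h, rfl⟩ := Nat.exists_eq_add_of_le' hn
  have hf : (h.factorial : ℚ) ≠ 0 := by exact_mod_cast h.factorial_ne_zero
  have e1 : wt (single 1 (h + 1)) + deg (single 1 (h + 1)) - 2 = 2 * h := by
    rw [wt_single, deg_single]; omega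
  rw [tau, e1, deg_single, factorial_two_mul_eq, gam_single, Nat.factorial_succ]
  push_cast
  rw [pow_succ]
  have : (h : ℚ) + 1 ≠ 0 := by positivity
  field_simp

theorem tau_sub_tau {v : ℕ →₀ ℕ} {s ε h l M : ℕ} (hv : v 1 = 0) (h0 : v ≠ 0)
    (hs : wt v + deg v = 2 * (s + 1) + ε) (hε : ε ≤ 1) (hl : Even l) (hM : M + l = h + s) :
    tau (single 1 h + v) - (if l ≤ h then tau (single 1 (h - l) + v) else 0) =
      (-1) ^ (h + deg v - 1) *
        ((2 ^ s * ((M + l).descFactorial s * oddProd (M + l + ε)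
          - M.descFactorial s * oddProd (M + ε)) : ℤ) : ℚ) / gam v := by
  have hd := deg_ne_zero h0
  rw [tau_single_one_add h hv hs hε, hM]
  split_ifs with hlh
  · obtain ⟨q, rfl⟩ := Nat.exists_eq_add_of_le' hlh
    obtain rfl : M = q + s := by omega
    rw [Nat.add_sub_cancel, tau_single_one_add q hv hs hε,
      show q + l + deg v - 1 = q + deg v - 1 + l by omega, pow_add, hl.neg_one_pow]
    push_cast
    ring
  · rw [Nat.descFactorial_of_lt (show M < s by omega)]
    simp

theorem TwoPowDvd.signed_sub {t G j : ℕ} {A C : ℤ} {c : ℚ} (hG : G ≠ 0) (hc : c * G = C)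
    (h : (2 : ℤ) ^ (t + padicValNat 2 G) ∣ A + C ∧ Odd j ∨
      (2 : ℤ) ^ (t + padicValNat 2 G) ∣ A - C ∧ (2 : ℤ) ^ (t + padicValNat 2 G) ∣ 2 * C) :
    TwoPowDvd t ((-1) ^ j * (A : ℚ) / G - c) := by
  have hG' : (G : ℚ) ≠ 0 := by exact_mod_cast hG
  have e : (-1) ^ j * (A : ℚ) / G - c = (((-1) ^ j * A - C : ℤ) : ℚ) / G := by
    push_cast
    rw [← hc, sub_div, mul_div_cancel_right₀ _ hG']
  rw [e]
  refine TwoPowDvd.of_dvd hG ?_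
  rcases h with ⟨h, hj⟩ | ⟨h, h2⟩
  · rw [hj.neg_one_pow]
    exact (dvd_neg.mpr h).trans (dvd_of_eq (by ring))
  · rcases neg_one_pow_eq_or ℤ j with hj | hj <;> rw [hj]
    · rwa [one_mul]
    · exact (dvd_neg.mpr (dvd_add h h2)).trans (dvd_of_eq (by ring))

/-- The coefficient of `c_1 ^ h * c ^ v` in the correction terms of the congruence,
for `v` without parts equal to `1`. -/
def correction (l : ℕ) (v : ℕ →₀ ℕ) : ℚ :=
  (if v = single 3 1 then (l : ℚ) / 2 else 0)
    + ((if v = single 3 2 then (l : ℚ) / 4 else 0) + (if v = single 3 4 then (l : ℚ) / 4 else 0))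
    + ((if v = single 3 2 + single 2 1 then (l : ℚ) else 0)
      + (if v = single 3 1 + single 2 1 then (l : ℚ) else 0))

theorem correction_eq {l w : ℕ} {v : ℕ →₀ ℕ} (hw : wt v = w) (h3 : w ≠ 3) (h6 : w ≠ 6)
    (h12 : w ≠ 12) (h8 : w ≠ 8) (h5 : w ≠ 5) : correction l v = 0 := by
  have h {u : ℕ →₀ ℕ} (hu : w ≠ wt u) : v ≠ u := fun e => hu (by rw [← hw, e])
  rw [correction, if_neg (h (by rwa [wt_single])), if_neg (h (by rwa [wt_single])),
    if_neg (h (by rwa [wt_single])), if_neg (h (by rwa [wt_add, wt_single, wt_single])),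
    if_neg (h (by rwa [wt_add, wt_single, wt_single]))]
  norm_num

theorem correction_eq_zero_of_not_isExceptional {l : ℕ} {v : ℕ →₀ ℕ} (h : ¬ IsExceptional v) :
    correction l v = 0 := by
  simp only [IsExceptional, not_or] at h
  simp [correction, h]

theorem ne_of_wt_ne {u v : ℕ →₀ ℕ} (h : wt u ≠ wt v) : u ≠ v := fun e => h (by rw [e])

theorem twoPowDvd_tau_sub_of_lt {N m l h s ε : ℕ} {v : ℕ →₀ ℕ} (hN : 3 ≤ N) (hm : 2 * N + 1 ≤ m)
    (hm8 : m % 8 = 4) (hv : ∀ i, v i ≠ 0 → 2 ≤ i)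
    (hs : wt v + deg v = 2 * (s + 1) + ε) (hε : ε ≤ 1) (hw : h + wt v = m + l) (hlt : h + s < l) :
    TwoPowDvd (N + 1) (tau (single 1 h + v) - (if l ≤ h then tau (single 1 (h - l) + v) else 0)
      - correction l v) := by
  have hv1 : v 1 = 0 := by
    by_contra hcon
    have := hv 1 hcon
    omega
  rw [if_neg (by omega), sub_zero, tau_single_one_add h hv1 hs hε,
    correction_eq rfl (by omega) (by omega) (by omega) (by omega) (by omega)]
  have hle := padicValNat_gam_add_le (N := N) hv hs hε (by omega) (by omega) (by omega : 12 + s <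
      wt v)
  have hd := two_pow_dvd_two_pow_mul_descFactorial (a := N + 1 + padicValNat 2 (gam v))
    (s := s) (by omega) (h + s)
  refine TwoPowDvd.signed_sub (C := 0) (gam_ne_zero v) (by simp) (Or.inr ⟨?_, by simp⟩)
  rw [sub_zero, ← mul_assoc]
  exact hd.mul_right _

theorem twoPowDvd_tau_sub {N k m l h s ε : ℕ} {v : ℕ →₀ ℕ} (hN : 3 ≤ N) (hl : l = k * 2 ^ N)
    (hm : 2 * N + 1 ≤ m) (hm8 : m % 8 = 4) (hv : ∀ i, v i ≠ 0 → 2 ≤ i) (h0 : v ≠ 0)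
    (hs : wt v + deg v = 2 * (s + 1) + ε) (hε : ε ≤ 1) (hw : h + wt v = m + l) :
    TwoPowDvd (N + 1) (tau (single 1 h + v) - (if l ≤ h then tau (single 1 (h - l) + v) else 0)
      - correction l v) := by
  rcases Nat.lt_or_ge (h + s) l with hlt | hge
  · exact twoPowDvd_tau_sub_of_lt hN hm hm8 hv hs hε hw hlt
  obtain ⟨M, hM⟩ := Nat.exists_eq_add_of_le' hge
  have hv1 : v 1 = 0 := by
    by_contra hcon
    have := hv 1 hcon
    omega
  obtain ⟨r, rfl⟩ := Nat.exists_eq_add_of_le hN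
  have hl8 : l = 8 * (k * 2 ^ r) := by rw [hl]; ring
  generalize k * 2 ^ r = y at hl8
  have hle : Even l := by rw [hl8]; exact Even.mul_right (by decide) _
  rw [tau_sub_tau hv1 h0 hs hε hle hM.symm]
  by_cases hE : IsExceptional v
  swap
  · have hlog := padicValNat_gam_add_log_lt hv h0 hs hε hE
    rw [correction_eq_zero_of_not_isExceptional hE]
    refine TwoPowDvd.signed_sub (C := 0) (gam_ne_zero v) (by simp) (Or.inr ⟨?_, by simp⟩)
    rw [sub_zero]
    exact two_pow_dvd_term_sub_of_log hN hl hlog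
  obtain ⟨t, ht⟩ : ∃ t, m = 8 * t + 12 := ⟨m / 8 - 1, by omega⟩
  rcases hE with rfl | rfl | rfl | rfl | rfl | rfl | rfl | rfl | rfl | rfl | rfl
  · have hg := padicValNat_two_of_eq (g := 0) (o := 3) (by decide) (gam_single 2 1)
    simp only [wt_single, deg_single] at hs hw
    obtain ⟨rfl, rfl⟩ : s = 0 ∧ ε = 1 := by omega
    rw [correction_eq (wt_single 2 1) (by norm_num) (by norm_num) (by norm_num) (by norm_num)
      (by norm_num)]
    refine TwoPowDvd.signed_sub (C := 0) (gam_ne_zero _) (by simp) (Or.inr ⟨?_, by simp⟩)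
    rw [hg, sub_zero]
    exact two_pow_dvd_term_sub hN hl (by simp) (by simp)
  · have hg := padicValNat_two_of_eq (g := 3) (o := 1) (by decide) (gam_single 7 1)
    simp only [wt_single, deg_single] at hs hw
    obtain ⟨rfl, rfl⟩ : s = 3 ∧ ε = 0 := by omega
    rw [correction_eq (wt_single 7 1) (by norm_num) (by norm_num) (by norm_num) (by norm_num)
      (by norm_num)]
    refine TwoPowDvd.signed_sub (C := 0) (gam_ne_zero _) (by simp) (Or.inr ⟨?_, by simp⟩)
    rw [hg, sub_zero]
    exact two_pow_dvd_term_sub_three (t := t + 1) hN hl (by omega)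
  · have hgam : gam (single 3 1 + single 2 1) = 2 ^ 2 * 3 := by
      rw [gam_single_add 1 (by simp), gam_single]; rfl
    have hg := padicValNat_two_of_eq (g := 2) (o := 3) (by decide) hgam
    simp only [wt_add, deg_add, wt_single, deg_single] at hs hw ⊢
    obtain ⟨rfl, rfl⟩ : s = 2 ∧ ε = 1 := by omega
    refine TwoPowDvd.signed_sub (C := 12 * l) (gam_ne_zero _) ?_ (Or.inr ⟨?_, ?_⟩)
    · rw [hgam]
      norm_num [correction, ne_of_wt_ne, wt_add, wt_single]
      ring
    · rw [hg]
      exact two_pow_dvd_term_three_two (t := t + 1) hN hl (by omega)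
    · rw [hg, hl]
      exact ⟨3 * k, by push_cast; ring⟩
  · have hgam : gam (single 3 2 + single 2 1) = 2 ^ 5 * 3 := by
      rw [gam_single_add 2 (by simp), gam_single]; rfl
    have hg := padicValNat_two_of_eq (g := 5) (o := 3) (by decide) hgam
    simp only [wt_add, deg_add, wt_single, deg_single] at hs hw ⊢
    obtain ⟨rfl, rfl⟩ : s = 4 ∧ ε = 1 := by omega
    refine TwoPowDvd.signed_sub (C := 96 * l) (gam_ne_zero _) ?_ (Or.inr ⟨?_, ?_⟩)
    · rw [hgam]
      norm_num [correction, ne_of_wt_ne, wt_add, wt_single]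
      ring
    · rw [hg]
      exact two_pow_dvd_term_three_three_two (t := t + 1) hN hl (by omega)
    · rw [hg, hl]
      exact ⟨3 * k, by push_cast; ring⟩
  · have hg := padicValNat_two_of_eq (g := 2) (o := 1) (by decide) (gam_single 3 1)
    simp only [wt_single, deg_single] at hs hw ⊢
    obtain ⟨rfl, rfl⟩ : s = 1 ∧ ε = 0 := by omega
    refine TwoPowDvd.signed_sub (C := 2 * l) (gam_ne_zero _) ?_
      (Or.inl ⟨?_, Nat.odd_iff.mpr (by omega)⟩)
    · rw [gam_single]
      norm_num [correction, Finsupp.single_left_inj, Nat.factorial, ne_of_wt_ne, wt_add, wt_single]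
      ring
    · rw [hg]
      exact two_pow_dvd_term_single_three_one (t := t + 1) hN hl (by omega)
  · have hg := padicValNat_two_of_eq (g := 5) (o := 1) (by decide) (gam_single 3 2)
    simp only [wt_single, deg_single] at hs hw ⊢
    obtain ⟨rfl, rfl⟩ : s = 3 ∧ ε = 0 := by omega
    refine TwoPowDvd.signed_sub (C := 8 * l) (gam_ne_zero _) ?_
      (Or.inl ⟨?_, Nat.odd_iff.mpr (by omega)⟩)
    · rw [gam_single]
      norm_num [correction, Finsupp.single_left_inj, Nat.factorial, ne_of_wt_ne, wt_add, wt_single]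
      ring
    · rw [hg]
      exact two_pow_dvd_term_single_three_two (t := t + 1) hN hl (by omega)
  · have hg := padicValNat_two_of_eq (g := 7) (o := 3) (by decide) (gam_single 3 3)
    simp only [wt_single, deg_single] at hs hw
    obtain ⟨rfl, rfl⟩ : s = 5 ∧ ε = 0 := by omega
    rw [correction_eq (wt_single 3 3) (by norm_num) (by norm_num) (by norm_num) (by norm_num)
      (by norm_num)]
    refine TwoPowDvd.signed_sub (C := 0) (gam_ne_zero _) (by simp) (Or.inr ⟨?_, by simp⟩)
    rw [hg, sub_zero]
    exact two_pow_dvd_term_sub_five (t := t + 1) hN hl (by omega)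
  · have hg := padicValNat_two_of_eq (g := 11) (o := 3) (by decide) (gam_single 3 4)
    simp only [wt_single, deg_single] at hs hw ⊢
    obtain ⟨rfl, rfl⟩ : s = 7 ∧ ε = 0 := by omega
    refine TwoPowDvd.signed_sub (C := 1536 * l) (gam_ne_zero _) ?_
      (Or.inl ⟨?_, Nat.odd_iff.mpr (by omega)⟩)
    · rw [gam_single]
      norm_num [correction, Finsupp.single_left_inj, Nat.factorial, ne_of_wt_ne, wt_add, wt_single]
      ring
    · rw [hg]
      exact two_pow_dvd_term_single_three_four (t := t) hN hl (by omega)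
  · have hg := padicValNat_two_of_eq (g := 13) (o := 15) (by decide) (gam_single 3 5)
    simp only [wt_single, deg_single] at hs hw
    obtain ⟨rfl, rfl⟩ : s = 9 ∧ ε = 0 := by omega
    rw [correction_eq (wt_single 3 5) (by norm_num) (by norm_num) (by norm_num) (by norm_num)
      (by norm_num)]
    refine TwoPowDvd.signed_sub (C := 0) (gam_ne_zero _) (by simp) (Or.inr ⟨?_, by simp⟩)
    rw [hg, sub_zero]
    exact two_pow_dvd_term_sub_nine (t := t + 1) hN hl (by omega)
  · have hg := padicValNat_two_of_eq (g := 16) (o := 45) (by decide) (gam_single 3 6)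
    simp only [wt_single, deg_single] at hs hw
    obtain ⟨rfl, rfl⟩ : s = 11 ∧ ε = 0 := by omega
    rw [correction_eq (wt_single 3 6) (by norm_num) (by norm_num) (by norm_num) (by norm_num)
      (by norm_num)]
    refine TwoPowDvd.signed_sub (C := 0) (gam_ne_zero _) (by simp) (Or.inr ⟨?_, by simp⟩)
    rw [hg, sub_zero]
    exact two_pow_dvd_term_sub_eleven (t := t + 1) hN hl (by omega)
  · have hg := padicValNat_two_of_eq (g := 23) (o := 315) (by decide) (gam_single 3 8)
    simp only [wt_single, deg_single] at hs hw
    obtain ⟨rfl, rfl⟩ : s = 15 ∧ ε = 0 := by omega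
    rw [correction_eq (wt_single 3 8) (by norm_num) (by norm_num) (by norm_num) (by norm_num)
      (by norm_num)]
    refine TwoPowDvd.signed_sub (C := 0) (gam_ne_zero _) (by simp) (Or.inr ⟨?_, by simp⟩)
    rw [hg, sub_zero]
    exact two_pow_dvd_term_sub_fifteen (t := t + 1) hN hl (by omega)

theorem sum_toMultiset_eq_wt (u : ℕ →₀ ℕ) : (toMultiset u).sum = wt u := by
  induction u using Finsupp.induction_linear with
  | zero => rfl
  | add f g hf hg => rw [map_add, Multiset.sum_add, hf, hg, wt_add]
  | single i a => rw [toMultiset_single, Multiset.sum_nsmul, Multiset.sum_singleton, wt_single,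
      smul_eq_mul, mul_comm]

theorem coeff_divB (n : ℕ) (u : ℕ →₀ ℕ) :
    coeff u (divB n) = if u 0 = 0 ∧ wt u = n then tau u else 0 := by
  rw [divB, coeff_sum]
  simp only [coeff_smul, coeff_monomial, smul_eq_mul, mul_ite, mul_one, mul_zero]
  split_ifs with h
  · have hpos : ∀ {i}, i ∈ toMultiset u → 0 < i := fun {i} hi => by
      rw [mem_toMultiset, Finsupp.mem_support_iff] at hi
      exact Nat.pos_of_ne_zero (by rintro rfl; exact hi h.1)
    rw [Finset.sum_eq_single ⟨toMultiset u, hpos, by rw [sum_toMultiset_eq_wt, h.2]⟩]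
    · simp
    · rintro P - hP
      refine if_neg fun e => hP ?_
      ext1
      exact (Multiset.toFinsupp_eq_iff.mp e)
    · simp
  · refine Finset.sum_eq_zero fun P _ => if_neg fun e => h ?_
    have e' := Multiset.toFinsupp_eq_iff.mp e
    constructor
    · rw [← e, Multiset.toFinsupp_apply, Multiset.count_eq_zero]
      exact fun h0 => lt_irrefl _ (P.parts_pos h0)
    · rw [← sum_toMultiset_eq_wt, ← e', P.parts_sum]

theorem coeff_X_one_pow_mul_divB (l m : ℕ) (u : ℕ →₀ ℕ) :
    coeff u (X 1 ^ l * divB m) =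
      if u 0 = 0 ∧ wt u = m + l then
        (if l ≤ u 1 then tau (single 1 (u 1 - l) + u.erase 1) else 0) else 0 := by
  have hle : single 1 l ≤ u ↔ l ≤ u 1 := by simp [Finsupp.single_le_iff]
  rw [X_pow_eq_monomial, coeff_monomial_mul', one_mul, coeff_divB]
  simp only [hle]
  by_cases hl : l ≤ u 1
  · have e : u - single 1 l = single 1 (u 1 - l) + u.erase 1 := by
      ext i
      by_cases hi : i = 1
      · subst hi; simp
      · simp [hi]
    have hz : (u - single 1 l : ℕ →₀ ℕ) 0 = u 0 := by simp
    have hw : wt (u - single 1 l) + l = wt u := by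
      have := wt_eq_add_erase 1 u
      rw [e, wt_add, wt_single]
      omega
    have hiff : wt (u - single 1 l) = m ↔ wt u = m + l := by omega
    rw [if_pos hl, if_pos hl, hz, ← e]
    simp only [hiff]
  · simp [hl]

theorem single_add_eq_iff {n a : ℕ} {u w : ℕ →₀ ℕ} (hw : w 1 = 0) (ha : a + wt w = n)
    (hu : wt u = n) : single 1 a + w = u ↔ u.erase 1 = w := by
  have hw' : w.erase 1 = w := Finsupp.erase_of_notMem_support (by simpa using hw)
  constructor
  · rintro rfl
    rw [Finsupp.erase_add, Finsupp.erase_single, zero_add, hw']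
  · rintro rfl
    have := wt_eq_add_erase 1 u
    obtain rfl : a = u 1 := by omega
    exact Finsupp.single_add_erase 1 u

theorem single_add_ne {n a : ℕ} {u w : ℕ →₀ ℕ} (hw : w 0 = 0) (ha : a + wt w = n)
    (hu : ¬ (u 0 = 0 ∧ wt u = n)) : single 1 a + w ≠ u := by
  rintro rfl
  exact hu ⟨by simp [hw], by rw [wt_add, wt_single, one_mul, ha]⟩

theorem twoPowDvd_tau_single_one {N k l m : ℕ} (hN : 3 ≤ N) (hl : l = k * 2 ^ N)
    (hm8 : m % 8 = 4) :
    TwoPowDvd (N + 1) (tau (single 1 (m + l)) - tau (single 1 m)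
      - ((l : ℚ) - l / (2 * m * (m + l : ℕ)))) := by
  obtain ⟨t, rfl⟩ : ∃ t, m = 8 * t + 4 := ⟨m / 8, by omega⟩
  have h := two_pow_dvd_leading_term (m := 8 * t + 4) hN hl rfl
  obtain ⟨r, rfl⟩ := Nat.exists_eq_add_of_le hN
  have hl8 : l = 8 * (k * 2 ^ r) := by rw [hl]; ring
  have hg := padicValNat_two_of_eq (g := 5) (o := (2 * t + 1) * (2 * t + 1 + 2 * (k * 2 ^ r)))
    (n := 2 * (8 * t + 4) * (8 * t + 4 + l)) ?_ (by rw [hl8]; ring)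
  · rw [show (2 : ℤ) ^ (3 + r + 6) = 2 ^ (3 + r + 1 + 5) by ring, ← hg] at h
    convert TwoPowDvd.of_dvd (by positivity) h using 1
    have o1 : Odd (8 * t + 4 - 1) := Nat.odd_iff.mpr (by omega)
    have o2 : Odd (8 * t + 4 + l - 1) := Nat.odd_iff.mpr (by omega)
    rw [tau_single_one _ (by omega), tau_single_one _ (by omega), o1.neg_one_pow, o2.neg_one_pow]
    have p1 : (8 * (t : ℚ) + 4) ≠ 0 := by positivity
    have p2 : (8 * (t : ℚ) + 4 + l) ≠ 0 := by positivity
    push_cast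
    field_simp
    ring
  · exact (Nat.odd_iff.mpr (by omega)).mul (Nat.odd_iff.mpr (by omega))

theorem X_pow_mul_X_pow_eq_monomial (a b : ℕ) :
    (X 1 ^ a * X 3 ^ b : MvPolynomial ℕ ℚ) = monomial (single 1 a + single 3 b) 1 := by
  rw [X_pow_eq_monomial, X_pow_eq_monomial, monomial_mul, one_mul]

theorem X_pow_mul_X_mul_X_pow_eq_monomial (a b : ℕ) :
    (X 1 ^ a * X 2 * X 3 ^ b : MvPolynomial ℕ ℚ) =
      monomial (single 1 a + (single 3 b + single 2 1)) 1 := by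
  rw [X_pow_eq_monomial, X_pow_eq_monomial, X, monomial_mul, monomial_mul, one_mul, one_mul,
    add_assoc, add_comm (single 2 1)]

/-- universal Kummer congruence mod 2^{N+1}, case m ≡ 4 (mod 8):
l = k·2^N (k odd), m ≥ 2N+1, n = m + l ≥ 12. -/
theorem stmt_19 (N k : ℕ) (hN : 3 ≤ N) (hk : 1 ≤ k) (hkodd : Odd k)
    (l m n : ℕ) (hl : l = k * 2 ^ N) (hm : 2 * N + 1 ≤ m) (hmmod : m % 8 = 4)
    (hn : n = m + l) (hn12 : 12 ≤ n) :
    PCong 2 (N + 1) (divB n)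
      (X 1 ^ l * divB m
        + C ((l : ℚ) - (l : ℚ) / (2 * (m : ℚ) * (n : ℚ))) * X 1 ^ n
        + C ((l : ℚ) / 2) * X 1 ^ (n - 3) * X 3
        + C ((l : ℚ) / 4) * (X 1 ^ (n - 6) * X 3 ^ 2 + X 1 ^ (n - 12) * X 3 ^ 4)
        + C (l : ℚ) * (X 1 ^ (n - 8) * X 2 * X 3 ^ 2 + X 1 ^ (n - 5) * X 2 * X 3)) := by
  intro u
  apply TwoPowDvd.le_pval
  have hX3 : (X 3 : MvPolynomial ℕ ℚ) = X 3 ^ 1 := (pow_one _).symm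
  have hX1 : (X 1 ^ n : MvPolynomial ℕ ℚ) = monomial (single 1 n + 0) 1 := by
    rw [X_pow_eq_monomial, add_zero]
  rw [mul_assoc (C ((l : ℚ) / 2)), mul_add (C (l : ℚ)), hX3, ← pow_mul, ← pow_mul, one_mul, one_mul,
    hX1, X_pow_mul_X_pow_eq_monomial, X_pow_mul_X_pow_eq_monomial, X_pow_mul_X_pow_eq_monomial,
    X_pow_mul_X_mul_X_pow_eq_monomial, X_pow_mul_X_mul_X_pow_eq_monomial]
  simp only [coeff_sub, coeff_add, coeff_C_mul, mul_add, coeff_X_one_pow_mul_divB, coeff_divB,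
    coeff_monomial, mul_ite, mul_one, mul_zero]
  by_cases hu : u 0 = 0 ∧ wt u = n
  · have e (a : ℕ) {w : ℕ →₀ ℕ} (hw : w 1 = 0) (ha : a + wt w = n) :
        single 1 a + w = u ↔ u.erase 1 = w := single_add_eq_iff hw ha hu.2
    rw [if_pos hu, if_pos (by rwa [← hn])]
    simp only [e n (w := 0) rfl (by rw [wt_zero, add_zero]),
      e (n - 3) (w := single 3 1) (by simp) (by rw [wt_single]; omega),
      e (n - 6) (w := single 3 2) (by simp) (by rw [wt_single]; omega),
      e (n - 12) (w := single 3 4) (by simp) (by rw [wt_single]; omega),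
      e (n - 8) (w := single 3 2 + single 2 1) (by simp)
        (by rw [wt_add, wt_single, wt_single]; omega),
      e (n - 5) (w := single 3 1 + single 2 1) (by simp)
        (by rw [wt_add, wt_single, wt_single]; omega)]
    have hv : ∀ i, u.erase 1 i ≠ 0 → 2 ≤ i := fun i hi => by
      obtain ⟨h1, h2⟩ := erase_ne_zero_imp hi
      have : i ≠ 0 := by rintro rfl; exact h1 hu.1
      omega
    have hw := wt_eq_add_erase 1 u
    have htau : tau u = tau (single 1 (u 1) + u.erase 1) := by rw [Finsupp.single_add_erase]
    rw [htau]
    generalize u 1 = h at *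
    generalize u.erase 1 = v at *
    rcases eq_or_ne v 0 with rfl | h0
    · obtain rfl : h = m + l := by rw [wt_zero] at hw; omega
      have hne {i a : ℕ} (ha : a ≠ 0) : (0 : ℕ →₀ ℕ) ≠ single i a :=
        (Finsupp.single_ne_zero.mpr ha).symm
      have hne' {w : ℕ →₀ ℕ} (hw : wt w ≠ 0) : (0 : ℕ →₀ ℕ) ≠ w :=
        ne_of_wt_ne (by rw [wt_zero]; exact hw.symm)
      convert twoPowDvd_tau_single_one hN hl hmmod using 1
      rw [if_pos (Nat.le_add_left l m), if_pos rfl, if_neg (hne (by norm_num)),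
        if_neg (hne (by norm_num)), if_neg (hne (by norm_num)),
        if_neg (hne' (by rw [wt_add, wt_single, wt_single]; norm_num)),
        if_neg (hne' (by rw [wt_add, wt_single, wt_single]; norm_num)), Nat.add_sub_cancel, hn]
      simp only [add_zero]
      ring
    · obtain ⟨i, hi⟩ := Finsupp.ne_iff.mp h0
      rw [Finsupp.zero_apply] at hi
      have h2 : 2 ≤ wt v := by
        rw [wt_eq_add_erase i]
        exact ((hv i hi).trans (Nat.le_mul_of_pos_right i (Nat.pos_of_ne_zero hi))).trans
          (Nat.le_add_right _ _)
      convert twoPowDvd_tau_sub (s := (wt v + deg v) / 2 - 1) (ε := (wt v + deg v) % 2) hN hl hm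
        hmmod hv h0 (by omega) (by omega) (show h + wt v = m + l by omega) using 1
      rw [if_neg h0, correction]
      ring
  · have e (a : ℕ) {w : ℕ →₀ ℕ} (hw : w 0 = 0) (ha : a + wt w = n) : single 1 a + w ≠ u :=
      single_add_ne hw ha hu
    rw [if_neg hu, if_neg (by rwa [← hn]), if_neg (e n (w := 0) rfl (by rw [wt_zero, add_zero])),
      if_neg (e (n - 3) (by simp) (by rw [wt_single]; omega)),
      if_neg (e (n - 6) (by simp) (by rw [wt_single]; omega)),
      if_neg (e (n - 12) (by simp) (by rw [wt_single]; omega)),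
      if_neg (e (n - 8) (by simp) (by rw [wt_add, wt_single, wt_single]; omega)),
      if_neg (e (n - 5) (by simp) (by rw [wt_add, wt_single, wt_single]; omega))]
    simpa using twoPowDvd_zero (N + 1)

end
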